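/- arXiv:alg-geom/9703001 — 2 statements merged into one kernel-verified Lean document; each statement's English description precedes it below -/
import Mathlib

section
/- Let ζ, η ∈ S_∞ be disjoint permutations. Then the map (ξ,χ) ↦ ξ∘χ is an isomorphism of graded posets from the product [e,ζ]_≼ × [e,η]_≼ onto [e,ζ∘η]_≼: it is a bijection from {ξ : ξ ≼ ζ} × {χ : χ ≼ η} onto {ν : ν ≼ ζ∘η}; for all (ξ,χ) and (ξ',χ') in the domain, (ξ ≼ ξ' and χ ≼ χ') holds if and only if ξ∘χ ≼ ξ'∘χ'; and |ξ∘χ| = |ξ| + |χ|. -/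
/-- `S_∞`: a permutation of the positive integers lies in `S_∞` iff it
fixes all but finitely many integers. -/
def finSupp (w : Equiv.Perm ℕ+) : Prop := {i : ℕ+ | w i ≠ i}.Finite

/-- The length `ℓ(w) = #{(i,j) : i < j and w(i) > w(j)}`. -/
noncomputable def len (w : Equiv.Perm ℕ+) : ℕ :=
  {p : ℕ+ × ℕ+ | p.1 < p.2 ∧ w p.2 < w p.1}.ncard

/-- Cover relation of the `k`-Bruhat order: `w = u∘(a,b)` with `a ≤ k < b`
and `ℓ(w) = ℓ(u) + 1`. -/
def kBruhatCover (k : ℕ) (u w : Equiv.Perm ℕ+) : Prop :=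
  ∃ a b : ℕ+, (a : ℕ) ≤ k ∧ k < (b : ℕ) ∧ w = u * Equiv.swap a b ∧ len w = len u + 1

/-- The `k`-Bruhat order `≤_k`: reflexive–transitive closure of the cover relation. -/
def kBruhatLE (k : ℕ) : Equiv.Perm ℕ+ → Equiv.Perm ℕ+ → Prop :=
  Relation.ReflTransGen (kBruhatCover k)

/-- The rank `|ζ|` as an integer. -/
noncomputable def zlen (ζ : Equiv.Perm ℕ+) : ℤ :=
  ({p : ℕ+ × ℕ+ | p.1 ∈ (⇑ζ) '' {α | α < ζ α} ∧ p.2 ∈ (⇑ζ) '' {β | ζ β < β} ∧ p.2 < p.1}.ncard : ℤ)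
    - ({p : ℕ+ × ℕ+ | p.1 < ζ p.1 ∧ p.2 < ζ p.2 ∧ p.2 < p.1 ∧ ζ p.1 < ζ p.2}.ncard : ℤ)
    - ({p : ℕ+ × ℕ+ | ζ p.1 < p.1 ∧ ζ p.2 < p.2 ∧ p.2 < p.1 ∧ ζ p.1 < ζ p.2}.ncard : ℤ)
    - ({p : ℕ+ × ℕ+ | p.1 < ζ p.1 ∧ ζ p.2 < p.2 ∧ p.2 < p.1}.ncard : ℤ)

/-- The relation `≼` on `S_∞`: `η ≼ ζ` iff there exist a positive integer `k`
and `u ∈ S_∞` with `u ≤_k η∘u ≤_k ζ∘u`. -/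
def preceq (η ζ : Equiv.Perm ℕ+) : Prop :=
  ∃ k : ℕ, 0 < k ∧ ∃ u : Equiv.Perm ℕ+, finSupp u ∧
    kBruhatLE k u (η * u) ∧ kBruhatLE k (η * u) (ζ * u)

/-- `ζ` and `η` are disjoint: their supports are disjoint and `|ζ∘η| = |ζ| + |η|`. -/
def disjointPerm (ζ η : Equiv.Perm ℕ+) : Prop :=
  (∀ i : ℕ+, ζ i ≠ i → η i = i) ∧ zlen (ζ * η) = zlen ζ + zlen η

theorem finSupp.exists_bound {w : Equiv.Perm ℕ+} (hw : finSupp w) :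
    ∃ N : ℕ+, ∀ i, N < i → w i = i := by
  obtain ⟨N, hN⟩ := hw.bddAbove
  refine ⟨N, fun i hi => ?_⟩
  by_contra h
  exact absurd (hN (show i ∈ {i | w i ≠ i} from h)) (not_le.mpr hi)

theorem finSupp.mul {v w : Equiv.Perm ℕ+} (hv : finSupp v) (hw : finSupp w) :
    finSupp (v * w) := by
  refine (hv.union hw).subset fun i hi => ?_
  by_contra h
  rw [Set.mem_union, not_or] at h
  have h1 := not_not.mp h.1
  have h2 := not_not.mp h.2
  exact hi (by rw [Equiv.Perm.mul_apply, h2, h1])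

theorem finSupp.inv {w : Equiv.Perm ℕ+} (hw : finSupp w) : finSupp w⁻¹ := by
  refine hw.subset fun i hi h => hi ?_
  rw [Equiv.Perm.inv_eq_iff_eq, h]

theorem finSupp_swap (a b : ℕ+) : finSupp (Equiv.swap a b) := by
  refine (Set.toFinite {a, b}).subset fun i hi => ?_
  by_contra h
  simp only [Set.mem_insert_iff, Set.mem_singleton_iff, not_or] at h
  exact hi (Equiv.swap_apply_of_ne_of_ne h.1 h.2)

theorem apply_le_of_fix {w : Equiv.Perm ℕ+} {N : ℕ+} (hN : ∀ i, N < i → w i = i) {i : ℕ+}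
    (hi : i ≤ N) : w i ≤ N := by
  by_contra h
  rw [not_le] at h
  exact absurd (w.injective (hN _ h)) (fun e => by rw [e] at h; exact absurd hi (not_le.mpr h))

/-- The set of inversions of a permutation. -/
def invSet (w : Equiv.Perm ℕ+) : Set (ℕ+ × ℕ+) := {p | p.1 < p.2 ∧ w p.2 < w p.1}

theorem invSet_bound {w : Equiv.Perm ℕ+} {N : ℕ+} (hN : ∀ i, N < i → w i = i) {a b : ℕ+}
    (hab : a < b) (h : w b < w a) : a ≤ N ∧ b ≤ N := by
  suffices hb : b ≤ N from ⟨hab.le.trans hb, hb⟩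
  by_contra hb
  rw [not_le] at hb
  rw [hN b hb] at h
  by_cases ha : a ≤ N
  · exact absurd ((apply_le_of_fix hN ha).trans_lt hb) (not_lt.mpr h.le)
  · rw [hN a (not_le.mp ha)] at h
    exact lt_asymm h hab

theorem finite_invSet {w : Equiv.Perm ℕ+} (hw : finSupp w) : (invSet w).Finite := by
  obtain ⟨N, hN⟩ := hw.exists_bound
  refine ((Set.finite_Iic N).prod (Set.finite_Iic N)).subset ?_
  rintro ⟨a, b⟩ ⟨hab, h⟩
  exact invSet_bound hN hab h

/-- Exchange the positions `a` and `b` in a pair, if this does not reverse the pair. -/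
def swapPair (a b : ℕ+) (p : ℕ+ × ℕ+) : ℕ+ × ℕ+ :=
  if Equiv.swap a b p.1 < Equiv.swap a b p.2 then (Equiv.swap a b p.1, Equiv.swap a b p.2) else p

theorem swapPair_swapPair (a b : ℕ+) {p : ℕ+ × ℕ+} (hp : p.1 < p.2) :
    swapPair a b (swapPair a b p) = p := by
  unfold swapPair
  split_ifs <;> simp_all

theorem swapPair_injOn (a b : ℕ+) (w : Equiv.Perm ℕ+) : Set.InjOn (swapPair a b) (invSet w) := by
  intro p hp q hq h
  rw [← swapPair_swapPair a b hp.1, h, swapPair_swapPair a b hq.1]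

/-- A pair reversed by the transposition `(a,b)`. -/
theorem reversed_cases {a b i j : ℕ+} (hab : a < b) (hij : i < j)
    (h : ¬ Equiv.swap a b i < Equiv.swap a b j) :
    (i = a ∧ j = b) ∨ (i = a ∧ a < j ∧ j < b) ∨ (a < i ∧ i < b ∧ j = b) := by
  simp only [Equiv.swap_apply_def] at h
  split_ifs at h <;> grind

theorem swapPair_mem {u : Equiv.Perm ℕ+} {a b : ℕ+} (hab : a < b) (hu : u a < u b)
    {p : ℕ+ × ℕ+} (hp : p ∈ invSet u) :
    swapPair a b p ∈ invSet (u * Equiv.swap a b) ∧ swapPair a b p ≠ (a, b) := by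
  obtain ⟨i, j⟩ := p
  obtain ⟨hij, hinv⟩ := hp
  simp only at hij hinv
  unfold swapPair
  split_ifs with h
  · refine ⟨⟨h, by simpa using hinv⟩, fun e => ?_⟩
    simp only [Prod.mk.injEq, Equiv.swap_apply_eq_iff, Equiv.swap_apply_left,
      Equiv.swap_apply_right] at e
    rw [e.1, e.2] at hij
    exact lt_asymm hab hij
  · rcases reversed_cases hab hij h with ⟨rfl, rfl⟩ | ⟨rfl, h1, h2⟩ | ⟨h1, h2, rfl⟩
    · exact absurd hinv (lt_asymm hu)
    · refine ⟨⟨hij, ?_⟩, fun e => h2.ne (Prod.ext_iff.mp e).2⟩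
      simp only [Equiv.Perm.mul_apply, Equiv.swap_apply_left,
        Equiv.swap_apply_of_ne_of_ne h1.ne' h2.ne]
      exact hinv.trans hu
    · refine ⟨⟨hij, ?_⟩, fun e => h1.ne' (Prod.ext_iff.mp e).1⟩
      simp only [Equiv.Perm.mul_apply, Equiv.swap_apply_right,
        Equiv.swap_apply_of_ne_of_ne h1.ne' h2.ne]
      exact hu.trans hinv

theorem mem_invSet_mul_swap {u : Equiv.Perm ℕ+} {a b : ℕ+} (hab : a < b) (hu : u a < u b) :
    (a, b) ∈ invSet (u * Equiv.swap a b) := ⟨hab, by simpa using hu⟩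

theorem ncard_image_swapPair (a b : ℕ+) (u : Equiv.Perm ℕ+) :
    (swapPair a b '' invSet u).ncard = len u :=
  (swapPair_injOn a b u).ncard_image

theorem len_lt_len_mul_swap {u : Equiv.Perm ℕ+} (hfin : finSupp u) {a b : ℕ+} (hab : a < b)
    (hu : u a < u b) : len u + 1 ≤ len (u * Equiv.swap a b) := by
  rw [← ncard_image_swapPair a b u, ← Set.ncard_insert_of_notMem (a := (a, b))
    (by rintro ⟨p, hp, e⟩; exact (swapPair_mem hab hu hp).2 e) ((finite_invSet hfin).image _)]
  refine Set.ncard_le_ncard ?_ (finite_invSet (hfin.mul (finSupp_swap a b)))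
  rintro p (rfl | ⟨q, hq, rfl⟩)
  · exact mem_invSet_mul_swap hab hu
  · exact (swapPair_mem hab hu hq).1

theorem len_mul_swap_of_between {u : Equiv.Perm ℕ+} (hfin : finSupp u) {a b c : ℕ+} (hac : a < c)
    (hcb : c < b) (huac : u a < u c) (hucb : u c < u b) :
    len u + 2 ≤ len (u * Equiv.swap a b) := by
  have hab := hac.trans hcb
  have hu := huac.trans hucb
  have hnot : (a, c) ∉ swapPair a b '' invSet u := by
    rintro ⟨p, hp, e⟩
    have h := swapPair_swapPair a b hp.1
    rw [e, swapPair, if_neg] at h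
    · rw [← h] at hp
      exact lt_asymm huac hp.2
    · simp only [Equiv.swap_apply_left, Equiv.swap_apply_of_ne_of_ne hac.ne' hcb.ne]
      exact lt_asymm hcb
  have hfin' := (finite_invSet hfin).image (swapPair a b)
  rw [← ncard_image_swapPair a b u, ← one_add_one_eq_two, ← add_assoc,
    ← Set.ncard_insert_of_notMem hnot hfin',
    ← Set.ncard_insert_of_notMem (a := (a, b)) ?_ (hfin'.insert _)]
  · refine Set.ncard_le_ncard ?_ (finite_invSet (hfin.mul (finSupp_swap a b)))
    rintro p (rfl | rfl | ⟨q, hq, rfl⟩)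
    · exact mem_invSet_mul_swap hab hu
    · refine ⟨hac, ?_⟩
      simpa [Equiv.swap_apply_of_ne_of_ne hac.ne' hcb.ne] using hucb
    · exact (swapPair_mem hab hu hq).1
  · rintro (e | ⟨p, hp, e⟩)
    · exact hcb.ne' (Prod.ext_iff.mp e).2
    · exact (swapPair_mem hab hu hp).2 e

theorem len_mul_swap_of_forall {u : Equiv.Perm ℕ+} (hfin : finSupp u) {a b : ℕ+} (hab : a < b)
    (hu : u a < u b) (h : ∀ c, a < c → c < b → u a < u c → ¬ u c < u b) :
    len (u * Equiv.swap a b) = len u + 1 := by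
  refine le_antisymm ?_ (len_lt_len_mul_swap hfin hab hu)
  rw [← ncard_image_swapPair a b u]
  refine (Set.ncard_le_ncard ?_ (((finite_invSet hfin).image _).insert (a, b))).trans
    (Set.ncard_insert_le _ _)
  rintro ⟨i, j⟩ ⟨hij, hinv⟩
  simp only [Equiv.Perm.mul_apply] at hij hinv
  by_cases hs : Equiv.swap a b i < Equiv.swap a b j
  · refine Or.inr ⟨(Equiv.swap a b i, Equiv.swap a b j), ⟨hs, hinv⟩, ?_⟩
    simp [swapPair, hij]
  · have key : (i = a ∧ j = b) ∨ u j < u i := by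
      rcases reversed_cases hab hij hs with h' | ⟨rfl, h1, h2⟩ | ⟨h1, h2, rfl⟩
      · exact Or.inl h'
      · rw [Equiv.swap_apply_left, Equiv.swap_apply_of_ne_of_ne h1.ne' h2.ne] at hinv
        exact Or.inr ((not_lt.mp fun h' => h j h1 h2 h' hinv).lt_of_ne
          (u.injective.ne h1.ne'))
      · rw [Equiv.swap_apply_right, Equiv.swap_apply_of_ne_of_ne h1.ne' h2.ne] at hinv
        exact Or.inr ((not_lt.mp (h i h1 h2 hinv)).lt_of_ne (u.injective.ne h2.ne'))
    rcases key with ⟨rfl, rfl⟩ | key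
    · exact Or.inl rfl
    · exact Or.inr ⟨(i, j), ⟨hij, key⟩, by simp [swapPair, hs]⟩

theorem lt_of_len_mul_swap {u : Equiv.Perm ℕ+} (hfin : finSupp u) {a b : ℕ+} (hab : a < b)
    (h : len (u * Equiv.swap a b) = len u + 1) : u a < u b := by
  by_contra hu
  have hu' : u b < u a := (not_lt.mp hu).lt_of_ne (u.injective.ne hab.ne')
  have := len_lt_len_mul_swap (hfin.mul (finSupp_swap a b)) hab (by simpa using hu')
  rw [mul_assoc, Equiv.swap_mul_self, mul_one] at this
  omega

/-- The pointwise description of the `k`-Bruhat order. -/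
def KCrit (k : ℕ) (u w : Equiv.Perm ℕ+) : Prop :=
  (∀ a : ℕ+, (a : ℕ) ≤ k → u a ≤ w a) ∧ (∀ b : ℕ+, k < (b : ℕ) → w b ≤ u b) ∧
    ∀ a b : ℕ+, a < b → ((b : ℕ) ≤ k ∨ k < (a : ℕ)) → u a < u b → w a < w b

theorem KCrit.refl (k : ℕ) (u : Equiv.Perm ℕ+) : KCrit k u u :=
  ⟨fun _ _ => le_rfl, fun _ _ => le_rfl, fun _ _ _ _ h => h⟩

theorem KCrit.trans {k : ℕ} {u v w : Equiv.Perm ℕ+} (h : KCrit k u v) (h' : KCrit k v w) :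
    KCrit k u w :=
  ⟨fun a ha => (h.1 a ha).trans (h'.1 a ha), fun b hb => (h'.2.1 b hb).trans (h.2.1 b hb),
    fun a b hab hk hu => h'.2.2 a b hab hk (h.2.2 a b hab hk hu)⟩

theorem kCrit_mul_swap {k : ℕ} {u : Equiv.Perm ℕ+} {a b : ℕ+} (ha : (a : ℕ) ≤ k)
    (hb : k < (b : ℕ)) (hu : u a < u b) (h : ∀ c, a < c → c < b → u a < u c → ¬ u c < u b) :
    KCrit k u (u * Equiv.swap a b) := by
  have hsw : ∀ c, (u * Equiv.swap a b) c = if c = a then u b else if c = b then u a else u c := by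
    intro c
    simp only [Equiv.Perm.mul_apply, Equiv.swap_apply_def]
    split_ifs <;> rfl
  refine ⟨fun c hc => ?_, fun c hc => ?_, fun c d hcd hk hlt => ?_⟩
  · rw [hsw]
    split_ifs with h1 h2
    · rw [h1]; exact hu.le
    · subst h2; omega
    · exact le_rfl
  · rw [hsw]
    split_ifs with h1 h2
    · subst h1; omega
    · rw [h2]; exact hu.le
    · exact le_rfl
  · have hcd' : (c : ℕ) < d := hcd
    have hinj := u.injective.eq_iff (a := c) (b := a)
    have hinj' := u.injective.eq_iff (a := d) (b := b)
    have hdb := PNat.coe_lt_coe d b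
    have hac := PNat.coe_lt_coe a c
    rw [hsw, hsw]
    split_ifs <;> grind

theorem kBruhatCover.spec {k : ℕ} {u w : Equiv.Perm ℕ+} (hfin : finSupp u)
    (h : kBruhatCover k u w) :
    finSupp w ∧ KCrit k u w ∧ ∃ a b : ℕ+, (a : ℕ) ≤ k ∧ k < (b : ℕ) ∧ u a < u b ∧
      w = u * Equiv.swap a b := by
  obtain ⟨a, b, ha, hb, rfl, hlen⟩ := h
  have hab : a < b := PNat.coe_lt_coe _ _ |>.mp (ha.trans_lt hb)
  have hu := lt_of_len_mul_swap hfin hab hlen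
  refine ⟨hfin.mul (finSupp_swap a b), kCrit_mul_swap ha hb hu fun c h1 h2 h3 h4 => ?_,
    a, b, ha, hb, hu, rfl⟩
  have := len_mul_swap_of_between hfin h1 h2 h3 h4
  omega

theorem kBruhatLE.spec {k : ℕ} {u w : Equiv.Perm ℕ+} (hfin : finSupp u) (h : kBruhatLE k u w) :
    finSupp w ∧ KCrit k u w := by
  induction h with
  | refl => exact ⟨hfin, KCrit.refl k u⟩
  | tail _ hc ih => exact ⟨(hc.spec ih.1).1, ih.2.trans (hc.spec ih.1).2.1⟩

theorem KCrit.eq_of_forall {k : ℕ} {u w : Equiv.Perm ℕ+} (h : KCrit k u w)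
    (hle : ∀ a : ℕ+, (a : ℕ) ≤ k → u a = w a) : u = w := by
  have key : ∀ v : ℕ+, ∀ b, u b = v → u b = w b := by
    intro v
    induction v using PNat.strongInductionOn with
    | _ v ih =>
      rintro b rfl
      by_cases hb : (b : ℕ) ≤ k
      · exact hle b hb
      by_contra hne
      have hlt : w b < u b := (h.2.1 b (not_le.mp hb)).lt_of_ne (Ne.symm hne)
      obtain ⟨c, hc⟩ := u.surjective (w b)
      have hcw := ih _ hlt c hc
      have hcb : c = b := w.injective (hcw.symm.trans hc)
      rw [hcb] at hc
      exact hne hc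
  exact Equiv.ext fun b => key _ b rfl

theorem exists_descent {k : ℕ} {u w : Equiv.Perm ℕ+} (h : KCrit k u w) {a : ℕ+}
    (haw : u a < w a)
    (hmax : ∀ c : ℕ+, (c : ℕ) ≤ k → u a < u c → u c = w c) :
    ∃ b : ℕ+, k < (b : ℕ) ∧ u a < u b ∧ u b ≤ w a ∧ w b ≤ u a := by
  by_contra! hcon
  have key : ∀ v : ℕ+, ∀ b, u b = v → k < (b : ℕ) → u a < u b → u b ≤ w a → w b ≠ u b →
      False := by
    intro v
    induction v using PNat.strongInductionOn with
    | _ v ih =>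
      rintro b rfl hb hab hbw hne
      have hwb := hcon b hb hab hbw
      obtain ⟨c, hc⟩ := u.surjective (w b)
      have hcb : c ≠ b := fun e => hne (by rw [← hc, e])
      have hac : u a < u c := hc ▸ hwb
      by_cases hck : (c : ℕ) ≤ k
      · exact hcb (w.injective ((hmax c hck hac).symm.trans hc))
      · have hle := h.2.1 b hb
        exact ih (u c) (by rw [hc]; exact hle.lt_of_ne hne) c rfl (not_le.mp hck) hac
          ((hc.le.trans hle).trans hbw) (by rw [hc]; exact w.injective.ne hcb)
  obtain ⟨b, hb⟩ := u.surjective (w a)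
  have hba : b ≠ a := fun e => haw.ne (by rw [← hb, e])
  have hub : u a < u b := hb ▸ haw
  refine key _ b rfl (not_le.mp fun hbk => ?_) hub hb.le (by rw [hb]; exact w.injective.ne hba)
  exact hba (w.injective ((hmax b hbk hub).symm.trans hb))

theorem KCrit.exists_cover {k : ℕ} {u w : Equiv.Perm ℕ+} (hfin : finSupp u) (h : KCrit k u w)
    (hne : u ≠ w) : ∃ v a, kBruhatCover k u v ∧ KCrit k v w ∧ (a : ℕ+) ≤ k ∧ u a < v a := by
  have hex : ∃ a : ℕ+, (a : ℕ) ≤ k ∧ u a ≠ w a := by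
    by_contra! hcon
    exact hne (h.eq_of_forall hcon)
  have hfinite : {a : ℕ+ | (a : ℕ) ≤ k ∧ u a ≠ w a}.Finite :=
    (Set.finite_Iic (Nat.succPNat k)).subset fun a ha =>
      PNat.coe_le_coe _ _ |>.mp (by simpa using ha.1.trans (Nat.le_succ k))
  obtain ⟨a, ⟨hak, hane⟩, hamax⟩ := Set.exists_max_image _ u hfinite hex
  have haw : u a < w a := (h.1 a hak).lt_of_ne hane
  have hmax : ∀ c : ℕ+, (c : ℕ) ≤ k → u a < u c → u c = w c := by
    intro c hc hac
    by_contra hcne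
    exact absurd (hamax c ⟨hc, hcne⟩) (not_le.mpr hac)
  obtain ⟨b, ⟨hbk, hab, hba, hwb⟩, hbmin⟩ := exists_minimalFor_of_wellFoundedLT
    (fun b : ℕ+ => k < (b : ℕ) ∧ u a < u b ∧ u b ≤ w a ∧ w b ≤ u a) u
    (exists_descent h haw hmax)
  have hmin : ∀ c : ℕ+, k < (c : ℕ) → u a < u c → u c < u b → u a < w c := by
    intro c hc hac hcb
    by_contra hcon
    exact absurd (hbmin ⟨hc, hac, hcb.le.trans hba, not_lt.mp hcon⟩ hcb.le) (not_le.mpr hcb)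
  have hltab : a < b := PNat.coe_lt_coe _ _ |>.mp (hak.trans_lt hbk)
  have hbetween : ∀ c, a < c → c < b → u a < u c → ¬ u c < u b := by
    intro c hac hcb huac hucb
    by_cases hck : (c : ℕ) ≤ k
    · have h1 := h.2.2 a c hac (Or.inl hck) huac
      rw [← hmax c hck huac] at h1
      exact absurd (h1.trans hucb) (not_lt.mpr hba)
    · have h1 := h.2.2 c b hcb (Or.inr (not_le.mp hck)) hucb
      exact absurd (h1.trans_le hwb) (not_lt.mpr (hmin c (not_le.mp hck) huac hucb).le)
  have hsw : ∀ c, (u * Equiv.swap a b) c = if c = a then u b else if c = b then u a else u c := by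
    intro c
    simp only [Equiv.Perm.mul_apply, Equiv.swap_apply_def]
    split_ifs <;> rfl
  refine ⟨u * Equiv.swap a b, a, ⟨a, b, hak, hbk, rfl,
    len_mul_swap_of_forall hfin hltab hab hbetween⟩, ⟨fun c hc => ?_, fun c hc => ?_, ?_⟩, hak,
    by simpa using hab⟩
  · rw [hsw]
    split_ifs with h1 h2
    · rw [h1]; exact hba
    · subst h2; omega
    · exact h.1 c hc
  · rw [hsw]
    split_ifs with h1 h2
    · subst h1; omega
    · rw [h2]; exact hwb
    · exact h.2.1 c hc
  · intro c d hcd hk hlt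
    have hcd' : (c : ℕ) < d := hcd
    have hcrit := h.2.2 c d hcd hk
    have hda := hmax c
    have hdb := PNat.coe_lt_coe d b
    have hac := PNat.coe_lt_coe a c
    have hinj := u.injective.eq_iff (a := c) (b := a)
    have hinj' := u.injective.eq_iff (a := d) (b := b)
    have hmd := hmin d
    rw [hsw, hsw] at hlt
    split_ifs at hlt <;> grind

theorem KCrit.kBruhatLE {k : ℕ} {u w : Equiv.Perm ℕ+} (hfin : finSupp u) (h : KCrit k u w) :
    kBruhatLE k u w := by
  induction hn : ∑ i ∈ Finset.range k, ((w i.succPNat : ℕ) - u i.succPNat) using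
    Nat.strong_induction_on generalizing u with
  | _ n ih =>
    by_cases hne : u = w
    · rw [hne]; exact Relation.ReflTransGen.refl
    obtain ⟨v, a, hc, hv, hak, hlt⟩ := h.exists_cover hfin hne
    have hspec := hc.spec hfin
    refine Relation.ReflTransGen.head hc (ih _ ?_ hspec.1 hv rfl)
    rw [← hn]
    have hpos := a.pos
    refine Finset.sum_lt_sum (fun i hi => ?_) ⟨a.natPred, by
      rw [Finset.mem_range]; have := PNat.natPred_add_one a; omega, ?_⟩
    · have := hspec.2.1.1 i.succPNat (by simpa using hi)
      have := PNat.coe_le_coe _ _ |>.mpr this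
      omega
    · rw [PNat.succPNat_natPred]
      have h1 := PNat.coe_le_coe _ _ |>.mpr (hv.1 a hak)
      have h2 := PNat.coe_lt_coe _ _ |>.mpr hlt
      omega

theorem bijective_of_injective_of_fix {f : ℕ+ → ℕ+} (hf : Function.Injective f) {N : ℕ+}
    (hN : ∀ v, N < v → f v = v) : Function.Bijective f := by
  refine ⟨hf, fun y => ?_⟩
  by_cases hy : y ≤ N
  · have hmaps : Set.MapsTo f (Finset.Icc 1 N) (Finset.Icc 1 N) := by
      intro v hv
      simp only [Finset.coe_Icc, Set.mem_Icc, one_le, true_and] at hv ⊢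
      by_contra hlt
      exact hlt ((hf (hN _ (not_le.mp hlt))).trans_le hv)
    obtain ⟨v, -, hv⟩ := Finset.surjOn_of_injOn_of_card_le f hmaps hf.injOn le_rfl
      (show y ∈ (Finset.Icc 1 N : Set ℕ+) by simpa using hy)
    exact ⟨v, hv⟩
  · exact ⟨y, hN y (not_le.mp hy)⟩

theorem card_filter_Icc_lt {P : ℕ+ → Prop} [DecidablePred P] {v v' : ℕ+} (h : v < v')
    (hP : P v') : ((Finset.Icc 1 v).filter P).card < ((Finset.Icc 1 v').filter P).card := by
  refine Finset.card_lt_card ⟨Finset.filter_subset_filter _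
    (Finset.Icc_subset_Icc le_rfl h.le), fun hsub => ?_⟩
  have := hsub (show v' ∈ (Finset.Icc 1 v').filter P by simp [hP])
  simp only [Finset.mem_filter, Finset.mem_Icc] at this
  exact absurd this.1.2 (not_le.mpr h)

/-- The inverse of the Grassmannian permutation with values `S` in its first `#S` positions. -/
theorem exists_grassmannian (S : Finset ℕ+) :
    ∃ p : Equiv.Perm ℕ+, finSupp p ∧ (∀ v, (p v : ℕ) ≤ S.card ↔ v ∈ S) ∧
      ∀ v v', v < v' → (v ∈ S ↔ v' ∈ S) → p v < p v' := by
  classical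
  obtain ⟨N, hN⟩ : ∃ N : ℕ+, ∀ s ∈ S, s ≤ N := S.bddAbove.imp fun N h s hs => h hs
  let c : ℕ+ → ℕ := fun v => ((Finset.Icc 1 v).filter (· ∈ S)).card
  let d : ℕ+ → ℕ := fun v => ((Finset.Icc 1 v).filter (¬ · ∈ S)).card
  have hcd : ∀ v, c v + d v = v := fun v => by
    simp only [c, d]
    rw [Finset.card_filter_add_card_filter_not, PNat.card_Icc]
    simp
  have hc : ∀ v, c v ≤ S.card := fun v =>
    Finset.card_le_card fun s hs => (Finset.mem_filter.mp hs).2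
  have hcpos : ∀ v ∈ S, 0 < c v := fun v hv =>
    Finset.card_pos.mpr ⟨v, by simp [hv]⟩
  have hdpos : ∀ v, v ∉ S → 0 < d v := fun v hv =>
    Finset.card_pos.mpr ⟨v, by simp [hv]⟩
  have hcN : ∀ v, N < v → c v = S.card := fun v hv => by
    simp only [c]
    congr 1
    ext s
    simp only [Finset.mem_filter, Finset.mem_Icc, one_le, true_and, and_iff_right_iff_imp]
    exact fun hs => (hN s hs).trans hv.le
  let g : ℕ+ → ℕ := fun v => if v ∈ S then c v else S.card + d v
  have hg : ∀ v, 0 < g v := fun v => by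
    simp only [g]
    split_ifs with hv
    · exact hcpos v hv
    · have := hdpos v hv
      omega
  have hmem : ∀ v, g v ≤ S.card ↔ v ∈ S := fun v => by
    simp only [g]
    split_ifs with hv
    · simp [hv, hc]
    · have := hdpos v hv
      simp only [hv, iff_false]
      omega
  have hmono : ∀ v v', v < v' → (v ∈ S ↔ v' ∈ S) → g v < g v' := fun v v' h hS => by
    by_cases hv : v' ∈ S
    · simp only [g, if_pos hv, if_pos (hS.mpr hv)]
      exact card_filter_Icc_lt h hv
    · simp only [g, if_neg hv, if_neg (fun h' => hv (hS.mp h'))]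
      exact Nat.add_lt_add_left (card_filter_Icc_lt h hv) _
  have hinj : Function.Injective g := fun v v' h => by
    have hS : v ∈ S ↔ v' ∈ S := by rw [← hmem, ← hmem, h]
    rcases lt_trichotomy v v' with hlt | heq | hgt
    · exact absurd h (hmono v v' hlt hS).ne
    · exact heq
    · exact absurd h (hmono v' v hgt hS.symm).ne'
  have hfix : ∀ v, N < v → g v = v := fun v hv => by
    have hvS : v ∉ S := fun h => absurd (hN v h) (not_le.mpr hv)
    simp only [g, if_neg hvS]
    rw [← hcN v hv, hcd]
  let f : ℕ+ → ℕ+ := fun v => ⟨g v, hg v⟩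
  have hf : Function.Injective f := fun v v' h => hinj (congrArg Subtype.val h)
  have hfN : ∀ v, N < v → f v = v := fun v hv => Subtype.ext (hfix v hv)
  refine ⟨Equiv.ofBijective f (bijective_of_injective_of_fix hf hfN), ?_, hmem, hmono⟩
  refine (Set.finite_Iic N).subset fun v hv => ?_
  by_contra h
  exact hv (hfN v (not_le.mp h))

/-- The pointwise description of the order `≼`. -/
def Crit (ξ ζ : Equiv.Perm ℕ+) : Prop :=
  (∀ α, α ≤ ζ α → α ≤ ξ α ∧ ξ α ≤ ζ α) ∧ (∀ α, ζ α ≤ α → ζ α ≤ ξ α ∧ ξ α ≤ α) ∧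
    ∀ α β, α < β → ζ α < ζ β → ((α < ζ α ∧ β < ζ β) ∨ (ζ α < α ∧ ζ β < β)) → ξ α < ξ β

theorem Crit.fix {ξ ζ : Equiv.Perm ℕ+} (h : Crit ξ ζ) {α : ℕ+} (hα : ζ α = α) : ξ α = α :=
  le_antisymm (h.2.1 α hα.le).2 (h.1 α hα.ge).1

theorem Crit.finSupp {ξ ζ : Equiv.Perm ℕ+} (h : Crit ξ ζ) (hζ : finSupp ζ) : finSupp ξ :=
  hζ.subset fun _ hα h' => hα (h.fix h')

theorem Crit.lt_of_le {ξ ζ : Equiv.Perm ℕ+} (h : Crit ξ ζ) {α β : ℕ+} (hαβ : α < β)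
    (hζ : ζ α < ζ β) (hd : (α ≤ ζ α ∧ β ≤ ζ β) ∨ (ζ α ≤ α ∧ ζ β ≤ β)) : ξ α < ξ β := by
  have h1 := h.1 α
  have h2 := h.1 β
  have h3 := h.2.1 α
  have h4 := h.2.1 β
  have h5 := h.2.2 α β hαβ hζ
  grind

theorem crit_of_preceq {ξ ζ : Equiv.Perm ℕ+} (h : preceq ξ ζ) : Crit ξ ζ := by
  obtain ⟨k, -, u, hu, h1, h2⟩ := h
  obtain ⟨hξ, c1⟩ := h1.spec hu
  obtain ⟨-, c2⟩ := h2.spec hξ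
  have c := c1.trans c2
  have hpos : ∀ α, ((u⁻¹ α : ℕ) ≤ k → α ≤ ξ α ∧ ξ α ≤ ζ α) ∧
      (k < (u⁻¹ α : ℕ) → ζ α ≤ ξ α ∧ ξ α ≤ α) := by
    intro α
    refine ⟨fun hk => ⟨?_, ?_⟩, fun hk => ⟨?_, ?_⟩⟩
    · simpa using c1.1 _ hk
    · simpa using c2.1 _ hk
    · simpa using c2.2.1 _ hk
    · simpa using c1.2.1 _ hk
  refine ⟨fun α hα => ?_, fun α hα => ?_, fun α β hαβ hζ hd => ?_⟩
  · by_cases hk : (u⁻¹ α : ℕ) ≤ k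
    · exact (hpos α).1 hk
    · have := (hpos α).2 (not_le.mp hk)
      have e : ζ α = α := le_antisymm (this.1.trans this.2) hα
      rw [e] at this ⊢
      exact ⟨this.1, this.2⟩
  · by_cases hk : (u⁻¹ α : ℕ) ≤ k
    · have := (hpos α).1 hk
      have e : ζ α = α := le_antisymm hα (this.1.trans this.2)
      rw [e] at this ⊢
      exact ⟨this.1, this.2⟩
    · exact (hpos α).2 (not_le.mp hk)
  · have hside : ∀ a b : ℕ+, a = u⁻¹ α ∨ a = u⁻¹ β → b = u⁻¹ α ∨ b = u⁻¹ β →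
        ((b : ℕ) ≤ k ∨ k < (a : ℕ)) := by
      have hα := hpos α
      have hβ := hpos β
      rintro a b (rfl | rfl) (rfl | rfl) <;> grind
    rcases lt_trichotomy (u⁻¹ α) (u⁻¹ β) with hlt | heq | hgt
    · simpa using c1.2.2 _ _ hlt (hside _ _ (by simp) (by simp)) (by simpa using hαβ)
    · exact absurd (u⁻¹.injective heq) hαβ.ne
    · by_contra hcon
      have hξ' : ξ β < ξ α := (not_lt.mp hcon).lt_of_ne (ξ.injective.ne hαβ.ne')
      have := c2.2.2 _ _ hgt (hside _ _ (by simp) (by simp)) (by simpa using hξ')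
      exact lt_asymm hζ (by simpa using this)

theorem Crit.preceq {ξ ζ : Equiv.Perm ℕ+} (h : Crit ξ ζ) (hζ : _root_.finSupp ζ) :
    preceq ξ ζ := by
  obtain ⟨N, hN⟩ := hζ.exists_bound
  obtain ⟨p, hp, hmem, hmono⟩ := exists_grassmannian
    ((Finset.Icc 1 N).filter fun v => ζ⁻¹ v ≤ v)
  set S := (Finset.Icc 1 N).filter fun v => ζ⁻¹ v ≤ v
  have hNS : N ∈ S := by
    simp only [S, Finset.mem_filter, Finset.mem_Icc, one_le, le_refl, true_and]
    refine apply_le_of_fix (N := N) (fun i hi => ?_) le_rfl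
    rw [Equiv.Perm.inv_eq_iff_eq, hN i hi]
  have hup : ∀ α, ζ α ∈ S → α ≤ ζ α := fun α hα => by
    simpa using (Finset.mem_filter.mp hα).2
  have hdown : ∀ α, ζ α ∉ S → ζ α ≤ α := fun α hα => by
    by_contra hcon
    refine hα ?_
    simp only [S, Finset.mem_filter, Finset.mem_Icc, one_le, true_and]
    refine ⟨not_lt.mp fun hlt => ?_, by simpa using (not_le.mp hcon).le⟩
    exact hcon (ζ.injective (hN _ hlt)).le
  obtain ⟨u, hu, hpos⟩ : ∃ u, _root_.finSupp u ∧ ∀ a, ∃ α, u a = α ∧ p (ζ α) = a :=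
    ⟨ζ⁻¹ * p⁻¹, hζ.inv.mul hp.inv, fun a => ⟨_, rfl, by simp⟩⟩
  have hcmp : ∀ α β, p (ζ α) < p (ζ β) → (ζ α ∈ S ↔ ζ β ∈ S) → ζ α < ζ β := by
    intro α β hlt hS
    rcases lt_trichotomy (ζ α) (ζ β) with hlt' | heq | hgt
    · exact hlt'
    · rw [heq] at hlt
      exact absurd hlt (lt_irrefl _)
    · exact absurd hlt (lt_asymm (hmono _ _ hgt hS.symm))
  have hside : ∀ α β, p (ζ α) < p (ζ β) →
      (((p (ζ β) : ℕ)) ≤ S.card ∨ S.card < (p (ζ α) : ℕ)) →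
      (ζ α ∈ S ∧ ζ β ∈ S) ∨ (ζ α ∉ S ∧ ζ β ∉ S) := by
    intro α β hlt hk
    rw [← hmem, ← hmem]
    have : (p (ζ α) : ℕ) < p (ζ β) := hlt
    omega
  have c1 : KCrit S.card u (ξ * u) := by
    refine ⟨fun a ha => ?_, fun a ha => ?_, fun a b hab hk hlt => ?_⟩
    · obtain ⟨α, e, rfl⟩ := hpos a
      rw [Equiv.Perm.mul_apply, e]
      exact (h.1 α (hup α ((hmem _).mp ha))).1
    · obtain ⟨α, e, rfl⟩ := hpos a
      rw [Equiv.Perm.mul_apply, e]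
      exact (h.2.1 α (hdown α fun h' => absurd ((hmem _).mpr h') (not_le.mpr ha))).2
    · obtain ⟨α, e, rfl⟩ := hpos a
      obtain ⟨β, e', rfl⟩ := hpos b
      rw [Equiv.Perm.mul_apply, Equiv.Perm.mul_apply, e, e']
      rw [e, e'] at hlt
      rcases hside α β hab hk with ⟨h1, h2⟩ | ⟨h1, h2⟩
      · exact h.lt_of_le hlt (hcmp α β hab (by simp [h1, h2])) (Or.inl ⟨hup α h1, hup β h2⟩)
      · exact h.lt_of_le hlt (hcmp α β hab (by simp [h1, h2])) (Or.inr ⟨hdown α h1, hdown β h2⟩)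
  have c2 : KCrit S.card (ξ * u) (ζ * u) := by
    refine ⟨fun a ha => ?_, fun a ha => ?_, fun a b hab hk hlt => ?_⟩
    · obtain ⟨α, e, rfl⟩ := hpos a
      rw [Equiv.Perm.mul_apply, Equiv.Perm.mul_apply, e]
      exact (h.1 α (hup α ((hmem _).mp ha))).2
    · obtain ⟨α, e, rfl⟩ := hpos a
      rw [Equiv.Perm.mul_apply, Equiv.Perm.mul_apply, e]
      exact (h.2.1 α (hdown α fun h' => absurd ((hmem _).mpr h') (not_le.mpr ha))).1
    · obtain ⟨α, e, rfl⟩ := hpos a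
      obtain ⟨β, e', rfl⟩ := hpos b
      rw [Equiv.Perm.mul_apply, Equiv.Perm.mul_apply, e, e']
      rcases hside α β hab hk with ⟨h1, h2⟩ | ⟨h1, h2⟩
      · exact hcmp α β hab (by simp [h1, h2])
      · exact hcmp α β hab (by simp [h1, h2])
  exact ⟨S.card, Finset.card_pos.mpr ⟨N, hNS⟩, _, hu, c1.kBruhatLE hu,
    c2.kBruhatLE ((h.finSupp hζ).mul hu)⟩

/-- The contribution of the ordered pair `(x, y)` with images `(x', y')` to `zlen`. -/
def pairRank (x x' y y' : ℕ+) : ℤ :=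
  (if x < x' ∧ y' < y ∧ y' < x' then 1 else 0) - (if x < x' ∧ y < y' ∧ y < x ∧ x' < y' then 1 else 0)
    - (if x' < x ∧ y' < y ∧ y < x ∧ x' < y' then 1 else 0) - (if x < x' ∧ y' < y ∧ y < x then 1 else 0)

theorem ncard_eq_sum {P : ℕ+ → ℕ+ → Prop} [∀ a b, Decidable (P a b)] {F : Finset ℕ+}
    (h : ∀ a b, P a b → a ∈ F ∧ b ∈ F) :
    ({p : ℕ+ × ℕ+ | P p.1 p.2}.ncard : ℤ) = ∑ a ∈ F, ∑ b ∈ F, if P a b then 1 else 0 := by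
  have : {p : ℕ+ × ℕ+ | P p.1 p.2} = ((F ×ˢ F).filter fun p => P p.1 p.2 : Finset (ℕ+ × ℕ+)) := by
    ext ⟨a, b⟩
    simpa using h a b
  rw [this, Set.ncard_coe_finset, ← Finset.sum_product', Finset.card_filter]
  push_cast
  rfl

theorem len_eq_sum {w : Equiv.Perm ℕ+} {N : ℕ+} (hN : ∀ i, N < i → w i = i) :
    (len w : ℤ) = ∑ a ∈ Finset.Icc 1 N, ∑ b ∈ Finset.Icc 1 N,
      if a < b ∧ w b < w a then 1 else 0 :=
  ncard_eq_sum (P := fun a b => a < b ∧ w b < w a) fun a b h => by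
    simpa using invSet_bound hN h.1 h.2

theorem zlen_eq_sum {ζ : Equiv.Perm ℕ+} {F : Finset ℕ+} (hF : ∀ i, ζ i ≠ i → i ∈ F) :
    zlen ζ = ∑ x ∈ F, ∑ y ∈ F, pairRank x (ζ x) y (ζ y) := by
  have himg : {p : ℕ+ × ℕ+ | p.1 ∈ (⇑ζ) '' {α | α < ζ α} ∧ p.2 ∈ (⇑ζ) '' {β | ζ β < β} ∧
      p.2 < p.1} = Prod.map ζ ζ '' {p : ℕ+ × ℕ+ | p.1 < ζ p.1 ∧ ζ p.2 < p.2 ∧ ζ p.2 < ζ p.1} := by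
    ext ⟨x, y⟩
    constructor
    · rintro ⟨⟨a, ha, rfl⟩, ⟨b, hb, rfl⟩, h⟩
      exact ⟨(a, b), ⟨ha, hb, h⟩, rfl⟩
    · rintro ⟨⟨a, b⟩, ⟨ha, hb, h⟩, e⟩
      obtain ⟨rfl, rfl⟩ := Prod.mk.inj e
      exact ⟨⟨a, ha, rfl⟩, ⟨b, hb, rfl⟩, h⟩
  unfold zlen
  rw [himg, Set.ncard_image_of_injective _ (ζ.injective.prodMap ζ.injective),
    ncard_eq_sum (F := F) (P := fun a b => a < ζ a ∧ ζ b < b ∧ ζ b < ζ a)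
      fun a b h => ⟨hF a h.1.ne', hF b h.2.1.ne⟩,
    ncard_eq_sum (F := F) (P := fun a b => a < ζ a ∧ b < ζ b ∧ b < a ∧ ζ a < ζ b)
      fun a b h => ⟨hF a h.1.ne', hF b h.2.1.ne'⟩,
    ncard_eq_sum (F := F) (P := fun a b => ζ a < a ∧ ζ b < b ∧ b < a ∧ ζ a < ζ b)
      fun a b h => ⟨hF a h.1.ne, hF b h.2.1.ne⟩,
    ncard_eq_sum (F := F) (P := fun a b => a < ζ a ∧ ζ b < b ∧ b < a)
      fun a b h => ⟨hF a h.1.ne', hF b h.2.1.ne⟩]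
  simp only [pairRank, Finset.sum_sub_distrib]

/-- The signed number of arcs of `ζ` passing over `t`, arc by arc. -/
def arcSign (x x' t : ℕ+) : ℤ := (if t < x' then 1 else 0) - (if t < x then 1 else 0)

theorem sum_arcSign {ζ : Equiv.Perm ℕ+} {F : Finset ℕ+} (hF : ∀ i, ζ i ≠ i → i ∈ F) (t : ℕ+) :
    ∑ x ∈ F, arcSign x (ζ x) t = 0 := by
  simp only [arcSign, Finset.sum_sub_distrib]
  rw [Equiv.Perm.sum_comp ζ F (fun x => if t < x then (1 : ℤ) else 0) (fun i hi => hF i hi),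
    sub_self]

/-- The change in inversion number of a pair of positions. -/
def invChange (p x x' q y y' : ℕ+) : ℤ :=
  (if p < q ∧ y' < x' then 1 else 0) - (if p < q ∧ y < x then 1 else 0)

/-- The correction term of a pair whose first member is fixed. -/
def fixTerm (k : ℕ) (p x x' y y' : ℕ+) : ℤ :=
  if x' = x then (if (p : ℕ) ≤ k then -1 else 1) * arcSign y y' x else 0

theorem invChange_add_of_lt {k : ℕ} {p x x' q y y' : ℕ+} (hpq : p < q) (hxy : x ≠ y)
    (hxy' : x' ≠ y')
    (h : ((p : ℕ) ≤ k ∧ (q : ℕ) ≤ k ∧ x ≤ x' ∧ y ≤ y' ∧ (x < y → x' < y')) ∨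
      (k < (p : ℕ) ∧ k < (q : ℕ) ∧ x' ≤ x ∧ y' ≤ y ∧ (x < y → x' < y')) ∨
      ((p : ℕ) ≤ k ∧ k < (q : ℕ) ∧ x ≤ x' ∧ y' ≤ y)) :
    invChange p x x' q y y' + invChange q y y' p x x' =
      pairRank x x' y y' + pairRank y y' x x' + fixTerm k p x x' y y' + fixTerm k q y y' x x' := by
  have h1 : invChange q y y' p x x' = 0 := by simp [invChange, hpq.le.not_gt]
  have h2 : invChange p x x' q y y' = (if y' < x' then 1 else 0) - (if y < x then 1 else 0) := by
    simp [invChange, hpq]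
  rw [h1, h2]
  simp only [pairRank, fixTerm, arcSign, ← PNat.coe_lt_coe, ← PNat.coe_inj,
    ← PNat.coe_le_coe, ne_eq] at hxy hxy' h ⊢
  clear h1 h2 hpq
  generalize (p : ℕ) = m at *
  generalize (q : ℕ) = n at *
  generalize (x : ℕ) = a at *
  generalize (y : ℕ) = b at *
  generalize (x' : ℕ) = c at *
  generalize (y' : ℕ) = d at *
  rcases h with ⟨hp, hq, hx, hy, h⟩ | ⟨hp, hq, hx, hy, h⟩ | ⟨hp, hq, hx, hy⟩
  all_goals
    first | rw [if_pos hp, if_pos hq] | rw [if_pos hp, if_neg hq.not_ge] |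
      rw [if_neg hp.not_ge, if_neg hq.not_ge]
    clear hp hq
    rcases hx.lt_or_eq with hx | hx <;> rcases hy.lt_or_eq with hy | hy <;>
    rcases lt_or_gt_of_ne hxy with h2 | h2 <;>
    rcases lt_or_gt_of_ne hxy' with h3 | h3 <;>
    rcases lt_or_ge a d with h6 | h6 <;>
    rcases lt_or_ge b c with h7 | h7 <;>
    first
    | (exfalso; omega)
    | (simp (disch := omega) only [if_pos, if_neg]; norm_num)

theorem invChange_add {k : ℕ} {u ζ : Equiv.Perm ℕ+} (h : KCrit k u (ζ * u)) (x y : ℕ+) :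
    invChange (u⁻¹ x) x (ζ x) (u⁻¹ y) y (ζ y) + invChange (u⁻¹ y) y (ζ y) (u⁻¹ x) x (ζ x) =
      pairRank x (ζ x) y (ζ y) + pairRank y (ζ y) x (ζ x) +
        fixTerm k (u⁻¹ x) x (ζ x) y (ζ y) + fixTerm k (u⁻¹ y) y (ζ y) x (ζ x) := by
  have key : ∀ x y, u⁻¹ x < u⁻¹ y →
      invChange (u⁻¹ x) x (ζ x) (u⁻¹ y) y (ζ y) + invChange (u⁻¹ y) y (ζ y) (u⁻¹ x) x (ζ x) =
        pairRank x (ζ x) y (ζ y) + pairRank y (ζ y) x (ζ x) +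
          fixTerm k (u⁻¹ x) x (ζ x) y (ζ y) + fixTerm k (u⁻¹ y) y (ζ y) x (ζ x) := by
    intro x y hlt
    have hne : x ≠ y := fun e => by rw [e] at hlt; exact lt_irrefl _ hlt
    have hlt' : (u⁻¹ x : ℕ) < u⁻¹ y := hlt
    have hup : ∀ z, (u⁻¹ z : ℕ) ≤ k → z ≤ ζ z := fun z hz => by simpa using h.1 _ hz
    have hdown : ∀ z, k < (u⁻¹ z : ℕ) → ζ z ≤ z := fun z hz => by simpa using h.2.1 _ hz
    have hmono : ((u⁻¹ y : ℕ) ≤ k ∨ k < (u⁻¹ x : ℕ)) → x < y → ζ x < ζ y := fun hk hxy => by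
      simpa using h.2.2 _ _ hlt hk (by simpa using hxy)
    refine invChange_add_of_lt hlt hne (ζ.injective.ne hne) ?_
    rcases le_or_gt (u⁻¹ y : ℕ) k with hy | hy
    · exact Or.inl ⟨(hlt'.trans_le hy).le, hy, hup x (hlt'.trans_le hy).le, hup y hy,
        hmono (Or.inl hy)⟩
    · rcases le_or_gt (u⁻¹ x : ℕ) k with hx | hx
      · exact Or.inr (Or.inr ⟨hx, hy, hup x hx, hdown y hy⟩)
      · exact Or.inr (Or.inl ⟨hx, hy, hdown x hx, hdown y hy, hmono (Or.inr hx)⟩)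
  rcases lt_trichotomy (u⁻¹ x) (u⁻¹ y) with hlt | heq | hgt
  · exact key x y hlt
  · obtain rfl := u⁻¹.injective heq
    simp [invChange, pairRank, fixTerm, arcSign]
    grind
  · have := key y x hgt
    linarith

theorem zlen_eq_len_sub_len {k : ℕ} {u ζ : Equiv.Perm ℕ+} (hu : finSupp u) (hζ : finSupp ζ)
    (h : KCrit k u (ζ * u)) : zlen ζ = len (ζ * u) - len u := by
  obtain ⟨N₁, hN₁⟩ := hu.exists_bound
  obtain ⟨N₂, hN₂⟩ := hζ.exists_bound
  set N := max N₁ N₂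
  have hNu : ∀ i, N < i → u i = i := fun i hi => hN₁ i ((le_max_left _ _).trans_lt hi)
  have hNζ : ∀ i, N < i → ζ i = i := fun i hi => hN₂ i ((le_max_right _ _).trans_lt hi)
  have hNζu : ∀ i, N < i → (ζ * u) i = i := fun i hi => by
    rw [Equiv.Perm.mul_apply, hNu i hi, hNζ i hi]
  set F := Finset.Icc 1 N
  have hF : ∀ v : Equiv.Perm ℕ+, (∀ i, N < i → v i = i) → ∀ i, v i ≠ i → i ∈ F :=
    fun v hv i hi => by
      simp only [F, Finset.mem_Icc, one_le, true_and]
      by_contra hcon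
      exact hi (hv i (not_le.mp hcon))
  have hreindex : ∀ f : ℕ+ → ℕ+ → ℤ, ∑ a ∈ F, ∑ b ∈ F, f a b =
      ∑ x ∈ F, ∑ y ∈ F, f (u⁻¹ x) (u⁻¹ y) := by
    have hinv : ∀ i, u⁻¹ i ≠ i → i ∈ F := hF _ fun i hi => by
      rw [Equiv.Perm.inv_eq_iff_eq, hNu i hi]
    intro f
    rw [← Equiv.Perm.sum_comp u⁻¹ F (fun a => ∑ b ∈ F, f a b) fun i hi => hinv i hi]
    exact Finset.sum_congr rfl fun x _ =>
      (Equiv.Perm.sum_comp u⁻¹ F (fun b => f (u⁻¹ x) b) fun i hi => hinv i hi).symm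
  have hlen : (len (ζ * u) : ℤ) - len u =
      ∑ x ∈ F, ∑ y ∈ F, invChange (u⁻¹ x) x (ζ x) (u⁻¹ y) y (ζ y) := by
    rw [len_eq_sum hNζu, len_eq_sum hNu,
      hreindex (fun a b => if a < b ∧ (ζ * u) b < (ζ * u) a then 1 else 0),
      hreindex (fun a b => if a < b ∧ u b < u a then 1 else 0), ← Finset.sum_sub_distrib]
    refine Finset.sum_congr rfl fun x _ => ?_
    rw [← Finset.sum_sub_distrib]
    refine Finset.sum_congr rfl fun y _ => ?_
    simp [invChange]
  have hfix : ∑ x ∈ F, ∑ y ∈ F, fixTerm k (u⁻¹ x) x (ζ x) y (ζ y) = 0 := by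
    refine Finset.sum_eq_zero fun x _ => ?_
    simp only [fixTerm]
    split_ifs
    · rw [← Finset.mul_sum, sum_arcSign (hF ζ hNζ), mul_zero]
    · rw [← Finset.mul_sum, sum_arcSign (hF ζ hNζ), mul_zero]
    · exact Finset.sum_const_zero
  have hsum := Finset.sum_congr rfl fun x (_ : x ∈ F) =>
    Finset.sum_congr rfl fun y (_ : y ∈ F) => invChange_add h x y
  simp only [Finset.sum_add_distrib] at hsum
  rw [Finset.sum_comm (f := fun x y => invChange (u⁻¹ y) y (ζ y) (u⁻¹ x) x (ζ x)),
    Finset.sum_comm (f := fun x y => pairRank y (ζ y) x (ζ x)),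
    Finset.sum_comm (f := fun x y => fixTerm k (u⁻¹ y) y (ζ y) x (ζ x)), hfix, ← hlen,
    ← zlen_eq_sum (hF ζ hNζ)] at hsum
  linarith

theorem preceq.zlen_eq_add {ξ ζ : Equiv.Perm ℕ+} (hζ : finSupp ζ) (h : preceq ξ ζ) :
    zlen ζ = zlen ξ + zlen (ζ * ξ⁻¹) := by
  have hξ := (crit_of_preceq h).finSupp hζ
  obtain ⟨k, -, u, hu, h1, h2⟩ := h
  obtain ⟨-, h1⟩ := h1.spec hu
  obtain ⟨-, h2⟩ := h2.spec (hξ.mul hu)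
  have h3 : ζ * ξ⁻¹ * (ξ * u) = ζ * u := by group
  rw [zlen_eq_len_sub_len hu hξ h1, zlen_eq_len_sub_len hu hζ (h1.trans h2),
    zlen_eq_len_sub_len (hξ.mul hu) (hζ.mul hξ.inv) (h3.symm ▸ h2), h3]
  ring

theorem pairRank_fix_left (x y y' : ℕ+) : pairRank x x y y' = 0 := by simp [pairRank]

theorem pairRank_fix_right (x x' y : ℕ+) : pairRank x x' y y = 0 := by
  simp only [pairRank, lt_self_iff_false, false_and, and_false, if_false, sub_zero]

/-- The arcs from `x` to `x'` and from `y` to `y'` point in the same direction and cross. -/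
abbrev Cross (x x' y y' : ℕ+) : Prop :=
  (x < y ∧ y < x' ∧ x' < y') ∨ (y < x ∧ x < y' ∧ y' < x') ∨
    (x' < y' ∧ y' < x ∧ x < y) ∨ (y' < x' ∧ x' < y ∧ y < x)

/-- The direction of the arc from `x` to `x'`. -/
def arcDir (x x' : ℕ+) : ℤ := (if x < x' then 1 else 0) - (if x' < x then 1 else 0)

theorem pairRank_add_swap {x x' y y' : ℕ+}
    (h : x ≠ x' → y ≠ y' → x ≠ y ∧ x ≠ y' ∧ x' ≠ y ∧ x' ≠ y') :
    2 * (pairRank x x' y y' + pairRank y y' x x') = 2 * (if Cross x x' y y' then 1 else 0) -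
      (arcDir y y' * (arcSign x x' y + arcSign x x' y') +
        arcDir x x' * (arcSign y y' x + arcSign y y' x')) := by
  rcases eq_or_ne x x' with rfl | hx
  · rw [pairRank_fix_left, pairRank_fix_right, if_neg (by grind)]
    simp [arcDir, arcSign]
  rcases eq_or_ne y y' with rfl | hy
  · rw [pairRank_fix_left, pairRank_fix_right, if_neg (by grind)]
    simp [arcDir, arcSign]
  obtain ⟨h1, h2, h3, h4⟩ := h hx hy
  simp only [pairRank, arcDir, arcSign, ← PNat.coe_lt_coe, ← PNat.coe_inj, ne_eq, Cross]
    at hx hy h1 h2 h3 h4 ⊢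
  generalize (x : ℕ) = a at *
  generalize (y : ℕ) = b at *
  generalize (x' : ℕ) = c at *
  generalize (y' : ℕ) = d at *
  rcases lt_or_gt_of_ne hx with hx | hx <;> rcases lt_or_gt_of_ne hy with hy | hy <;>
  rcases lt_or_gt_of_ne h1 with h1 | h1 <;>
  rcases lt_or_gt_of_ne h2 with h2 | h2 <;>
  rcases lt_or_gt_of_ne h3 with h3 | h3 <;>
  rcases lt_or_gt_of_ne h4 with h4 | h4 <;>
  first
  | (exfalso; omega)
  | (simp (disch := omega) only [if_pos, if_neg]; norm_num)

/-- No arc of `ζ` crosses an arc of `η` pointing in the same direction. -/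
def Noncrossing (ζ η : Equiv.Perm ℕ+) : Prop := ∀ x y, ¬ Cross x (ζ x) y (η y)

/-- The supports of `ζ` and `η` are disjoint. -/
def DisjointSupp (ζ η : Equiv.Perm ℕ+) : Prop := ∀ i, ζ i ≠ i → η i = i

theorem DisjointSupp.symm {ζ η : Equiv.Perm ℕ+} (h : DisjointSupp ζ η) : DisjointSupp η ζ :=
  fun i hi => by
    by_contra hne
    exact hi (h i hne)

theorem DisjointSupp.disjoint {ζ η : Equiv.Perm ℕ+} (h : DisjointSupp ζ η) :
    Equiv.Perm.Disjoint ζ η := fun i => or_iff_not_imp_left.mpr (h i)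

theorem DisjointSupp.commute {ζ η : Equiv.Perm ℕ+} (h : DisjointSupp ζ η) :
    ζ * η = η * ζ := h.disjoint.commute

theorem mul_apply_of_fix_right {ζ η : Equiv.Perm ℕ+} {i : ℕ+} (hi : η i = i) :
    (ζ * η) i = ζ i := by rw [Equiv.Perm.mul_apply, hi]

theorem DisjointSupp.mul_apply_of_fix {ζ η : Equiv.Perm ℕ+} (h : DisjointSupp ζ η) {i : ℕ+}
    (hi : ζ i = i) : (ζ * η) i = η i := by rw [h.commute, Equiv.Perm.mul_apply, hi]

theorem DisjointSupp.ne {ζ η : Equiv.Perm ℕ+} (h : DisjointSupp ζ η) {x y : ℕ+}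
    (hx : ζ x ≠ x) (hy : η y ≠ y) : x ≠ y ∧ x ≠ η y ∧ ζ x ≠ y ∧ ζ x ≠ η y := by
  have hx' : ζ (ζ x) ≠ ζ x := ζ.injective.ne hx
  have hy' : η (η y) ≠ η y := η.injective.ne hy
  refine ⟨?_, ?_, ?_, ?_⟩ <;> intro e
  · exact hy (h y (e ▸ hx))
  · exact hy' (h (η y) (e ▸ hx))
  · exact hy (h y (e ▸ hx'))
  · exact hy' (h (η y) (e ▸ hx'))

theorem DisjointSupp.zlen_mul {ζ η : Equiv.Perm ℕ+} (h : DisjointSupp ζ η) {F : Finset ℕ+}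
    (hFζ : ∀ i, ζ i ≠ i → i ∈ F) (hFη : ∀ i, η i ≠ i → i ∈ F) :
    zlen (ζ * η) = zlen ζ + zlen η +
      ∑ x ∈ F, ∑ y ∈ F, if Cross x (ζ x) y (η y) then 1 else 0 := by
  have hF : ∀ i, (ζ * η) i ≠ i → i ∈ F := fun i hi => by
    by_contra hcon
    have h1 : ζ i = i := by_contra fun h => hcon (hFζ i h)
    have h2 : η i = i := by_contra fun h => hcon (hFη i h)
    exact hi (by rw [Equiv.Perm.mul_apply, h2, h1])
  have hpair : ∀ x y, pairRank x ((ζ * η) x) y ((ζ * η) y) =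
      pairRank x (ζ x) y (ζ y) + pairRank x (η x) y (η y) + pairRank x (ζ x) y (η y) +
        pairRank x (η x) y (ζ y) := fun x y => by
    rcases h.disjoint x with hx | hx <;> rcases h.disjoint y with hy | hy
    · rw [h.mul_apply_of_fix hx, h.mul_apply_of_fix hy, hx, hy]
      simp [pairRank_fix_left, pairRank_fix_right]
    · rw [h.mul_apply_of_fix hx, mul_apply_of_fix_right hy, hx, hy]
      simp [pairRank_fix_left, pairRank_fix_right]
    · rw [mul_apply_of_fix_right hx, h.mul_apply_of_fix hy, hx, hy]
      simp [pairRank_fix_left, pairRank_fix_right]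
    · rw [mul_apply_of_fix_right hx, mul_apply_of_fix_right hy, hx, hy]
      simp [pairRank_fix_left, pairRank_fix_right]
  have hcross := Finset.sum_congr rfl fun x (_ : x ∈ F) => Finset.sum_congr rfl fun y (_ : y ∈ F) =>
    pairRank_add_swap (x := x) (x' := ζ x) (y := y) (y' := η y)
      fun hx hy => h.ne hx.symm hy.symm
  have h1 : ∑ x ∈ F, ∑ y ∈ F, arcDir y (η y) * (arcSign x (ζ x) y + arcSign x (ζ x) (η y)) = 0 := by
    rw [Finset.sum_comm]
    refine Finset.sum_eq_zero fun y _ => ?_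
    rw [← Finset.mul_sum, Finset.sum_add_distrib, sum_arcSign hFζ, sum_arcSign hFζ]
    simp
  have h2 : ∑ x ∈ F, ∑ y ∈ F, arcDir x (ζ x) * (arcSign y (η y) x + arcSign y (η y) (ζ x)) = 0 := by
    refine Finset.sum_eq_zero fun y _ => ?_
    rw [← Finset.mul_sum, Finset.sum_add_distrib, sum_arcSign hFη, sum_arcSign hFη]
    simp
  simp only [← Finset.mul_sum, Finset.sum_sub_distrib] at hcross
  simp only [Finset.sum_add_distrib, Finset.mul_sum] at hcross h1 h2
  rw [zlen_eq_sum hF, zlen_eq_sum hFζ, zlen_eq_sum hFη]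
  simp only [hpair, Finset.sum_add_distrib]
  rw [Finset.sum_comm (f := fun x y => pairRank x (η x) y (ζ y))]
  simp only [← Finset.mul_sum] at hcross h1 h2
  linarith

theorem DisjointSupp.exists_zlen_mul {ζ η : Equiv.Perm ℕ+} (h : DisjointSupp ζ η)
    (hζ : finSupp ζ) (hη : finSupp η) :
    ∃ n : ℕ, zlen (ζ * η) = zlen ζ + zlen η + n ∧ (n = 0 ↔ Noncrossing ζ η) := by
  let F : Finset ℕ+ := hζ.toFinset ∪ hη.toFinset
  have hFζ : ∀ i, ζ i ≠ i → i ∈ F := fun i hi =>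
    Finset.mem_union_left _ (hζ.mem_toFinset.mpr hi)
  have hFη : ∀ i, η i ≠ i → i ∈ F := fun i hi =>
    Finset.mem_union_right _ (hη.mem_toFinset.mpr hi)
  refine ⟨∑ x ∈ F, ∑ y ∈ F, if Cross x (ζ x) y (η y) then 1 else 0, ?_, ?_⟩
  · rw [h.zlen_mul hFζ hFη]
    push_cast
    rfl
  · simp only [Finset.sum_eq_zero_iff, ite_eq_right_iff, one_ne_zero, imp_false]
    refine ⟨fun hF x y hc => ?_, fun hnc x _ y _ => hnc x y⟩
    refine hF x (hFζ x fun e => ?_) y (hFη y fun e => ?_) hc <;> grind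

theorem DisjointSupp.noncrossing_iff {ζ η : Equiv.Perm ℕ+} (h : DisjointSupp ζ η)
    (hζ : finSupp ζ) (hη : finSupp η) :
    Noncrossing ζ η ↔ zlen (ζ * η) = zlen ζ + zlen η := by
  obtain ⟨n, hn, hiff⟩ := h.exists_zlen_mul hζ hη
  rw [← hiff, hn]
  omega

theorem DisjointSupp.le_zlen_mul {ζ η : Equiv.Perm ℕ+} (h : DisjointSupp ζ η)
    (hζ : finSupp ζ) (hη : finSupp η) : zlen ζ + zlen η ≤ zlen (ζ * η) := by
  obtain ⟨n, hn, -⟩ := h.exists_zlen_mul hζ hη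
  omega

theorem Noncrossing.symm {ζ η : Equiv.Perm ℕ+} (h : Noncrossing ζ η) : Noncrossing η ζ :=
  fun x y hc => h y x (by grind)

theorem DisjointSupp.mono {ζ η ξ χ : Equiv.Perm ℕ+} (h : DisjointSupp ζ η)
    (hξ : ∀ i, ζ i = i → ξ i = i) (hχ : ∀ i, η i = i → χ i = i) : DisjointSupp ξ χ :=
  fun i hi => hχ i (h i fun e => hi (hξ i e))

theorem Noncrossing.of_preceq {ζ η ξ χ : Equiv.Perm ℕ+} (hs : DisjointSupp ζ η)
    (h : Noncrossing ζ η) (hζ : finSupp ζ) (hη : finSupp η) (hξ : preceq ξ ζ) (hχ : preceq χ η)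
    (hξχ : preceq (ξ * χ) (ζ * η)) : Noncrossing ξ χ := by
  have hfξ := (crit_of_preceq hξ).finSupp hζ
  have hfχ := (crit_of_preceq hχ).finSupp hη
  have hξfix : ∀ i, ζ i = i → ξ i = i := fun i hi => (crit_of_preceq hξ).fix hi
  have hχfix : ∀ i, η i = i → χ i = i := fun i hi => (crit_of_preceq hχ).fix hi
  have hξinv : ∀ i, ζ i = i → ξ⁻¹ i = i := fun i hi => by
    rw [Equiv.Perm.inv_eq_iff_eq, hξfix i hi]
  have hχinv : ∀ i, η i = i → χ⁻¹ i = i := fun i hi => by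
    rw [Equiv.Perm.inv_eq_iff_eq, hχfix i hi]
  have hζξ : ∀ i, ζ i = i → (ζ * ξ⁻¹) i = i := fun i hi => by
    rw [Equiv.Perm.mul_apply, hξinv i hi, hi]
  have hηχ : ∀ i, η i = i → (η * χ⁻¹) i = i := fun i hi => by
    rw [Equiv.Perm.mul_apply, hχinv i hi, hi]
  have hcomm : ζ * η * (ξ * χ)⁻¹ = ζ * ξ⁻¹ * (η * χ⁻¹) := by
    have := (hs.mono hξinv hηχ).commute
    rw [mul_inv_rev, mul_assoc ζ ξ⁻¹, this]
    group
  have h1 := hξ.zlen_eq_add hζ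
  have h2 := hχ.zlen_eq_add hη
  have h3 := hξχ.zlen_eq_add (hζ.mul hη)
  rw [hcomm] at h3
  have h4 := (hs.noncrossing_iff hζ hη).mp h
  have h5 := (hs.mono hξfix hχfix).le_zlen_mul hfξ hfχ
  have h6 := (hs.mono hζξ hηχ).le_zlen_mul (hζ.mul hfξ.inv) (hη.mul hfχ.inv)
  rw [(hs.mono hξfix hχfix).noncrossing_iff hfξ hfχ]
  omega

theorem Crit.lt_of_noncrossing {ζ η ξ χ : Equiv.Perm ℕ+} (hs : DisjointSupp ζ η)
    (h : Noncrossing ζ η) (hξ : Crit ξ ζ) (hχ : Crit χ η) {α β : ℕ+} (hαβ : α < β)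
    (hlt : ζ α < η β) (hdir : (α < ζ α ∧ β < η β) ∨ (ζ α < α ∧ η β < β)) : ξ α < χ β := by
  have hc := h α β
  rcases hdir with ⟨hα, hβ⟩ | ⟨hα, hβ⟩
  · obtain ⟨-, -, hne, -⟩ := hs.ne hα.ne' hβ.ne'
    have hle : ζ α < β := lt_of_le_of_ne
      (not_lt.mp fun hlt' => hc (Or.inl ⟨hαβ, hlt', hlt⟩)) hne
    exact ((hξ.1 α hα.le).2.trans_lt hle).trans_le (hχ.1 β hβ.le).1
  · obtain ⟨-, hne, -, -⟩ := hs.ne hα.ne hβ.ne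
    have hle : α < η β := lt_of_le_of_ne
      (not_lt.mp fun hlt' => hc (Or.inr (Or.inr (Or.inl ⟨hlt, hlt', hαβ⟩)))) hne
    exact ((hξ.2.1 α hα.le).2.trans_lt hle).trans_le (hχ.2.1 β hβ.le).1

theorem Crit.mul {ζ η ξ χ : Equiv.Perm ℕ+} (hs : DisjointSupp ζ η) (h : Noncrossing ζ η)
    (hξ : Crit ξ ζ) (hχ : Crit χ η) : Crit (ξ * χ) (ζ * η) := by
  have hs' : DisjointSupp ξ χ := hs.mono (fun _ => hξ.fix) fun _ => hχ.fix
  have hcases : ∀ x, ((ζ * η) x = ζ x ∧ (ξ * χ) x = ξ x) ∨ ((ζ * η) x = η x ∧ (ξ * χ) x = χ x) :=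
    fun x => by
      rcases hs.disjoint x with hx | hx
      · exact Or.inr ⟨hs.mul_apply_of_fix hx, hs'.mul_apply_of_fix (hξ.fix hx)⟩
      · exact Or.inl ⟨mul_apply_of_fix_right hx, mul_apply_of_fix_right (hχ.fix hx)⟩
  refine ⟨fun α hα => ?_, fun α hα => ?_, fun α β hαβ hlt hdir => ?_⟩
  · rcases hcases α with ⟨h1, h2⟩ | ⟨h1, h2⟩ <;> rw [h1] at hα ⊢ <;> rw [h2]
    exacts [hξ.1 α hα, hχ.1 α hα]
  · rcases hcases α with ⟨h1, h2⟩ | ⟨h1, h2⟩ <;> rw [h1] at hα ⊢ <;> rw [h2]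
    exacts [hξ.2.1 α hα, hχ.2.1 α hα]
  · rcases hcases α with ⟨h1, h2⟩ | ⟨h1, h2⟩ <;> rcases hcases β with ⟨h3, h4⟩ | ⟨h3, h4⟩ <;>
      rw [h1, h3] at hlt hdir <;> rw [h2, h4]
    · exact hξ.2.2 α β hαβ hlt hdir
    · exact lt_of_noncrossing hs h hξ hχ hαβ hlt hdir
    · exact lt_of_noncrossing hs.symm h.symm hχ hξ hαβ hlt hdir
    · exact hχ.2.2 α β hαβ hlt hdir

theorem Crit.restrict {ν σ ξ ζ : Equiv.Perm ℕ+} (h : Crit ν σ)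
    (hx : ∀ x, (ν x = ξ x ∧ σ x = ζ x) ∨ (ξ x = x ∧ ζ x = x)) : Crit ξ ζ := by
  refine ⟨fun α hα => ?_, fun α hα => ?_, fun α β hαβ hlt hdir => ?_⟩
  · rcases hx α with ⟨h1, h2⟩ | ⟨h1, h2⟩
    · rw [← h1, ← h2]
      exact h.1 α (h2 ▸ hα)
    · simp [h1, h2]
  · rcases hx α with ⟨h1, h2⟩ | ⟨h1, h2⟩
    · rw [← h1, ← h2]
      exact h.2.1 α (h2 ▸ hα)
    · simp [h1, h2]
  · have hmove : ∀ x, ζ x ≠ x → ν x = ξ x ∧ σ x = ζ x := fun x hne =>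
      (hx x).resolve_right fun h' => hne h'.2
    obtain ⟨h1, h2⟩ := hmove α (by rcases hdir with hd | hd; exacts [hd.1.ne', hd.1.ne])
    obtain ⟨h3, h4⟩ := hmove β (by rcases hdir with hd | hd; exacts [hd.2.ne', hd.2.ne])
    rw [← h2, ← h4] at hlt hdir
    rw [← h1, ← h3]
    exact h.2.2 α β hαβ hlt hdir

theorem Crit.restrict_left {ξ χ ξ' χ' : Equiv.Perm ℕ+} (hs : DisjointSupp ξ χ')
    (hs' : DisjointSupp ξ' χ') (hχ : ∀ i, χ' i = i → χ i = i) (h : Crit (ξ * χ) (ξ' * χ')) :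
    Crit ξ ξ' := by
  refine h.restrict fun x => ?_
  rcases hs'.disjoint x with hx | hx
  · rcases hs.disjoint x with hx' | hx'
    · exact Or.inr ⟨hx', hx⟩
    · exact Or.inl ⟨mul_apply_of_fix_right (hχ x hx'), mul_apply_of_fix_right hx'⟩
  · exact Or.inl ⟨mul_apply_of_fix_right (hχ x hx), mul_apply_of_fix_right hx⟩

theorem exists_pow_apply_eq_self {ζ : Equiv.Perm ℕ+} (hζ : finSupp ζ) (a : ℕ+) :
    ∃ n : ℕ, (ζ ^ (n + 1)) a = a := by
  by_cases ha : ζ a = a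
  · exact ⟨0, by simpa using ha⟩
  have hmem : ∀ n : ℕ, (ζ ^ n) a ∈ {i | ζ i ≠ i} := fun n => by
    show ζ ((ζ ^ n) a) ≠ (ζ ^ n) a
    rw [← Equiv.Perm.mul_apply, ← pow_succ', pow_succ, Equiv.Perm.mul_apply]
    exact (ζ ^ n).injective.ne ha
  obtain ⟨i, j, hij, he⟩ := (hζ : {i | ζ i ≠ i}.Finite).exists_lt_map_eq_of_forall_mem hmem
  refine ⟨j - i - 1, (ζ ^ i).injective ?_⟩
  rw [← Equiv.Perm.mul_apply, ← pow_add, he]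
  congr 3
  omega

theorem sameCycle_induction {ζ : Equiv.Perm ℕ+} (hζ : finSupp ζ) {Q : ℕ+ → Prop}
    (hQ : ∀ c, Q c → Q (ζ c)) {a b : ℕ+} (ha : Q a) (hab : ζ.SameCycle a b) : Q b := by
  have hpow : ∀ (n : ℕ) c, Q c → Q ((ζ ^ n) c) := fun n c hc => by
    induction n with
    | zero => exact hc
    | succ n ih => rw [pow_succ']; exact hQ _ ih
  have hinv : ∀ c, Q c → Q (ζ⁻¹ c) := fun c hc => by
    obtain ⟨n, hn⟩ := exists_pow_apply_eq_self hζ c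
    have : ζ⁻¹ c = (ζ ^ n) c := by
      rw [Equiv.Perm.inv_eq_iff_eq, ← Equiv.Perm.mul_apply, ← pow_succ', hn]
    exact this ▸ hpow n c hc
  obtain ⟨z, rfl⟩ := hab
  induction z with
  | zero => exact ha
  | succ n ih => rw [add_comm, zpow_add, zpow_one]; exact hQ _ ih
  | pred n ih => rw [sub_eq_neg_add, zpow_add, zpow_neg_one]; exact hinv _ ih

theorem exists_arc_over {ζ : Equiv.Perm ℕ+} (hζ : finSupp ζ) {p s t : ℕ+} (hp : ζ p = p)
    (hst : ζ.SameCycle s t) (hs : s < p) (ht : p < t) :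
    ∃ a, ζ.SameCycle s a ∧ a < p ∧ p < ζ a := by
  by_contra hcon
  refine (sameCycle_induction hζ (Q := fun c => ζ.SameCycle s c ∧ c < p)
    (fun c hc => ⟨hc.1.apply_right, ?_⟩) ⟨.refl _ _, hs⟩ hst).2.not_gt ht
  refine lt_of_le_of_ne (not_lt.mp fun h => hcon ⟨c, hc.1, hc.2, h⟩) fun h => hc.2.ne ?_
  exact ζ.injective (h.trans hp.symm)

theorem exists_arc_under {ζ : Equiv.Perm ℕ+} (hζ : finSupp ζ) {p s t : ℕ+} (hp : ζ p = p)
    (hst : ζ.SameCycle s t) (hs : p < s) (ht : t < p) :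
    ∃ a, ζ.SameCycle s a ∧ p < a ∧ ζ a < p := by
  by_contra hcon
  refine (sameCycle_induction hζ (Q := fun c => ζ.SameCycle s c ∧ p < c)
    (fun c hc => ⟨hc.1.apply_right, ?_⟩) ⟨.refl _ _, hs⟩ hst).2.not_gt ht
  refine lt_of_le_of_ne (not_lt.mp fun h => hcon ⟨c, hc.1, hc.2, h⟩) fun h => hc.2.ne ?_
  exact ζ.injective (hp.trans h)

theorem Noncrossing.exists_sameCycle_lt {ζ η : Equiv.Perm ℕ+} (hs : DisjointSupp ζ η)
    (h : Noncrossing ζ η) (hζ : finSupp ζ) (hη : finSupp η) {x s t p q : ℕ+}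
    (hp : η p ≠ p) (hxs : ζ.SameCycle x s) (hxt : ζ.SameCycle x t) (hsp : s < p) (hpt : p < t)
    (hpq : η.SameCycle p q) : ∃ a, ζ.SameCycle x a ∧ a < q := by
  suffices hq : η q ≠ q ∧ (∃ a, ζ.SameCycle x a ∧ a < q) ∧ ∃ b, ζ.SameCycle x b ∧ q < b from hq.2.1
  refine sameCycle_induction hη
    (Q := fun q => η q ≠ q ∧ (∃ a, ζ.SameCycle x a ∧ a < q) ∧ ∃ b, ζ.SameCycle x b ∧ q < b)
    ?_ ⟨hp, ⟨s, hxs, hsp⟩, t, hxt, hpt⟩ hpq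
  rintro c ⟨hc, ⟨a, hxa, hac⟩, b, hxb, hcb⟩
  refine ⟨η.injective.ne hc, ?_⟩
  have hζc : ζ c = c := hs.symm c hc
  have hζc' : ζ (η c) = η c := hs.symm _ (η.injective.ne hc)
  rcases lt_or_gt_of_ne hc with hlt | hlt
  · obtain ⟨d, hbd, hcd, hdc⟩ := exists_arc_under hζ hζc (hxb.symm.trans hxa) hcb hac
    have hxd := hxb.trans hbd
    have hd : ζ d < η c := by
      refine lt_of_le_of_ne (not_lt.mp fun hlt' => h d c ?_) fun e => ?_
      · exact Or.inr (Or.inr (Or.inr ⟨hlt', hdc, hcd⟩))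
      · have : d = η c := ζ.injective (e.trans hζc'.symm)
        exact hlt.not_gt (this ▸ hcd)
    exact ⟨⟨ζ d, hxd.apply_right, hd⟩, d, hxd, hlt.trans hcd⟩
  · obtain ⟨d, had, hdc, hcd⟩ := exists_arc_over hζ hζc (hxa.symm.trans hxb) hac hcb
    have hxd := hxa.trans had
    have hd : η c < ζ d := by
      refine lt_of_le_of_ne (not_lt.mp fun hlt' => h d c ?_) fun e => ?_
      · exact Or.inl ⟨hdc, hcd, hlt'⟩
      · have : η c = d := ζ.injective (hζc'.trans e)
        exact hlt.not_gt (this ▸ hdc)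
    exact ⟨⟨d, hxd, hdc.trans hlt⟩, ζ d, hxd.apply_right, hd⟩

theorem Noncrossing.not_sameCycle_crossing {ζ η : Equiv.Perm ℕ+} (hs : DisjointSupp ζ η)
    (h : Noncrossing ζ η) (hζ : finSupp ζ) (hη : finSupp η) {s s' t t' : ℕ+}
    (hms : ζ s ≠ s) (hmt : η t ≠ t) (hss : ζ.SameCycle s s') (htt : η.SameCycle t t')
    (h1 : s < t) (h2 : t < s') (h3 : s' < t') : False := by
  have hms' : ζ s' ≠ s' := fun e => hms (by
    have := hss.symm.eq_of_left e
    rwa [this] at e)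
  have hT : ∀ q, η.SameCycle t q → ∃ a, ζ.SameCycle s a ∧ a < q := fun q hq =>
    h.exists_sameCycle_lt hs hζ hη hmt (.refl _ _) hss h1 h2 hq
  have hS : ∀ q, ζ.SameCycle s q → ∃ a, η.SameCycle t a ∧ a < q := fun q hq =>
    h.symm.exists_sameCycle_lt hs.symm hη hζ hms' (.refl _ _) htt h2 h3 (hss.symm.trans hq)
  obtain ⟨m, hm, hmin⟩ := WellFounded.has_min (wellFounded_lt (α := ℕ+))
    {i | ζ.SameCycle s i ∨ η.SameCycle t i} ⟨s, Or.inl (.refl _ _)⟩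
  rcases hm with hm | hm
  · obtain ⟨a, ha, hlt⟩ := hS m hm
    exact hmin a (Or.inr ha) hlt
  · obtain ⟨a, ha, hlt⟩ := hT m hm
    exact hmin a (Or.inl ha) hlt

theorem Crit.refl (ζ : Equiv.Perm ℕ+) : Crit ζ ζ :=
  ⟨fun _ h => ⟨h, le_rfl⟩, fun _ h => ⟨le_rfl, h⟩, fun _ _ _ h _ => h⟩

theorem Noncrossing.of_crit {ζ η ξ χ : Equiv.Perm ℕ+} (hs : DisjointSupp ζ η)
    (h : Noncrossing ζ η) (hζ : finSupp ζ) (hη : finSupp η) (hξ : Crit ξ ζ) (hχ : Crit χ η) :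
    Noncrossing ξ χ :=
  h.of_preceq hs hζ hη (hξ.preceq hζ) (hχ.preceq hη) ((hξ.mul hs h hχ).preceq (hζ.mul hη))

theorem Crit.swap_mul {ζ η ξ χ : Equiv.Perm ℕ+} (hs : DisjointSupp ζ η) (hξ : Crit ξ ζ)
    (hχ : Crit χ η) {α β : ℕ+} (hα : ξ α ≠ α) (hβ : ξ β ≠ β)
    (h : Crit (Equiv.swap (ξ α) (ξ β) * (ξ * χ)) (ζ * η)) :
    Crit (Equiv.swap (ξ α) (ξ β) * ξ) ζ := by
  rw [← mul_assoc] at h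
  refine h.restrict_left (fun i hi => ?_) hs fun i => hχ.fix
  by_contra hne
  have hξi : ξ i = i := hξ.fix (hs.symm i hne)
  have hαi : i ≠ ξ α := fun e => hα (ξ.injective (by rw [← e, hξi]))
  have hβi : i ≠ ξ β := fun e => hβ (ξ.injective (by rw [← e, hξi]))
  exact hi (by rw [Equiv.Perm.mul_apply, hξi, Equiv.swap_apply_of_ne_of_ne hαi hβi])

theorem Crit.exists_factor_swap_mul {ζ η ξ χ : Equiv.Perm ℕ+} (hs : DisjointSupp ζ η)
    (hnc : Noncrossing ζ η) (hζ : _root_.finSupp ζ)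
    (hη : _root_.finSupp η) (hξ : Crit ξ ζ) (hχ : Crit χ η)
    {α β : ℕ+} (h1 : α ≤ (ξ * χ) β) (h2 : (ξ * χ) β < (ξ * χ) α) (h3 : (ξ * χ) α ≤ β)
    (hν : Crit (Equiv.swap ((ξ * χ) α) ((ξ * χ) β) * (ξ * χ)) (ζ * η)) :
    ∃ ξ' χ', Crit ξ' ζ ∧ Crit χ' η ∧
      Equiv.swap ((ξ * χ) α) ((ξ * χ) β) * (ξ * χ) = ξ' * χ' := by
  have hs' : DisjointSupp ξ χ := hs.mono (fun _ => hξ.fix) fun _ => hχ.fix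
  have hnc' := hnc.of_crit hs hζ hη hξ hχ
  have hfξ := hξ.finSupp hζ
  have hfχ := hχ.finSupp hη
  rcases hs'.disjoint α with hα | hα <;> rcases hs'.disjoint β with hβ | hβ
  · rw [hs'.mul_apply_of_fix hα, hs'.mul_apply_of_fix hβ] at *
    rw [hs.commute, hs'.commute] at hν
    refine ⟨ξ, _, hξ, hχ.swap_mul hs.symm hξ (h1.trans_lt h2).ne' (h2.trans_le h3).ne hν, ?_⟩
    rw [hs'.commute, ← mul_assoc]
    refine DisjointSupp.commute fun i hi => ?_
    by_contra hne
    have hχi : χ i = i := hs' i hne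
    have hαi : i ≠ χ α := fun e => (h1.trans_lt h2).ne' (χ.injective (by rw [← e, hχi]))
    have hβi : i ≠ χ β := fun e => (h2.trans_le h3).ne (χ.injective (by rw [← e, hχi]))
    exact hi (by rw [Equiv.Perm.mul_apply, hχi, Equiv.swap_apply_of_ne_of_ne hαi hβi])
  · rw [hs'.mul_apply_of_fix hα, mul_apply_of_fix_right hβ] at *
    have hα' : χ α ≠ α := (h1.trans_lt h2).ne'
    have hβ' : ξ β ≠ β := (h2.trans_le h3).ne
    obtain ⟨-, -, h4, -⟩ := hs'.ne hβ' hα'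
    obtain ⟨-, h5, -, -⟩ := hs'.ne hβ' hα'
    exact (hnc'.symm.not_sameCycle_crossing hs'.symm hfχ hfξ hα' (ξ.injective.ne hβ')
      (Equiv.Perm.sameCycle_apply_right.mpr (.refl _ _))
      (Equiv.Perm.sameCycle_apply_left.mpr (.refl _ _))
      (lt_of_le_of_ne h1 h4.symm) h2 (lt_of_le_of_ne h3 h5.symm)).elim
  · rw [mul_apply_of_fix_right hα, hs'.mul_apply_of_fix hβ] at *
    have hα' : ξ α ≠ α := (h1.trans_lt h2).ne'
    have hβ' : χ β ≠ β := (h2.trans_le h3).ne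
    obtain ⟨-, h4, h5, -⟩ := hs'.ne hα' hβ'
    exact (hnc'.not_sameCycle_crossing hs' hfξ hfχ hα' (χ.injective.ne hβ')
      (Equiv.Perm.sameCycle_apply_right.mpr (.refl _ _))
      (Equiv.Perm.sameCycle_apply_left.mpr (.refl _ _))
      (lt_of_le_of_ne h1 h4) h2 (lt_of_le_of_ne h3 h5)).elim
  · rw [mul_apply_of_fix_right hα, mul_apply_of_fix_right hβ] at *
    exact ⟨_, χ, hξ.swap_mul hs hχ (h1.trans_lt h2).ne' (h2.trans_le h3).ne hν, hχ,
      (mul_assoc _ _ _).symm⟩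

theorem preceq.exists_factor {ζ η ν : Equiv.Perm ℕ+} (hs : DisjointSupp ζ η)
    (hnc : Noncrossing ζ η) (hζ : finSupp ζ) (hη : finSupp η) (h : preceq ν (ζ * η)) :
    ∃ ξ χ, Crit ξ ζ ∧ Crit χ η ∧ ν = ξ * χ := by
  obtain ⟨k, hk, u, hu, h1, h2⟩ := h
  suffices key : ∀ w, kBruhatLE k w (ζ * η * u) → kBruhatLE k u w →
      ∃ ξ χ, Crit ξ ζ ∧ Crit χ η ∧ w = ξ * χ * u by
    obtain ⟨ξ, χ, hξ, hχ, e⟩ := key _ h2 h1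
    exact ⟨ξ, χ, hξ, hχ, mul_right_cancel e⟩
  intro w hw
  induction hw using Relation.ReflTransGen.head_induction_on with
  | refl => exact fun _ => ⟨ζ, η, Crit.refl ζ, Crit.refl η, rfl⟩
  | @head v w hvw hw ih =>
    intro huv
    obtain ⟨ξ, χ, hξ, hχ, rfl⟩ := ih (huv.tail hvw)
    obtain ⟨hv, huv'⟩ := huv.spec hu
    obtain ⟨-, -, a, b, ha, hb, hab, hwv⟩ := hvw.spec hv
    have hva : v a = (ξ * χ) (u b) := by
      rw [← Equiv.Perm.mul_apply, hwv, Equiv.Perm.mul_apply, Equiv.swap_apply_right]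
    have hvb : v b = (ξ * χ) (u a) := by
      rw [← Equiv.Perm.mul_apply, hwv, Equiv.Perm.mul_apply, Equiv.swap_apply_left]
    have hv_eq : v = Equiv.swap ((ξ * χ) (u a)) ((ξ * χ) (u b)) * (ξ * χ) * u := by
      rw [← hva, ← hvb, mul_assoc, hwv, Equiv.mul_swap_eq_swap_mul, Equiv.swap_comm, ← mul_assoc,
        Equiv.swap_mul_self, one_mul]
    have hle := (Relation.ReflTransGen.single hvw).trans hw
    have hcrit : Crit (Equiv.swap ((ξ * χ) (u a)) ((ξ * χ) (u b)) * (ξ * χ)) (ζ * η) :=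
      crit_of_preceq ⟨k, hk, u, hu, hv_eq ▸ huv, hv_eq ▸ hle⟩
    obtain ⟨ξ', χ', hξ', hχ', e⟩ := hξ.exists_factor_swap_mul hs hnc hζ hη hχ
      (hva ▸ huv'.1 a ha) (hva ▸ hvb ▸ hab) (hvb ▸ huv'.2.1 b hb) hcrit
    exact ⟨ξ', χ', hξ', hχ', by rw [hv_eq, e]⟩

theorem DisjointSupp.injective_mul {ζ η ξ χ ξ' χ' : Equiv.Perm ℕ+} (hs : DisjointSupp ζ η)
    (hξ : ∀ i, ζ i = i → ξ i = i) (hχ : ∀ i, η i = i → χ i = i)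
    (hξ' : ∀ i, ζ i = i → ξ' i = i) (hχ' : ∀ i, η i = i → χ' i = i) (h : ξ * χ = ξ' * χ') :
    ξ = ξ' := by
  ext1 i
  rcases hs.disjoint i with hi | hi
  · rw [hξ i hi, hξ' i hi]
  · rw [← mul_apply_of_fix_right (ζ := ξ) (hχ i hi), h, mul_apply_of_fix_right (hχ' i hi)]

theorem Crit.left_of_mul {ζ η ξ χ ξ' χ' : Equiv.Perm ℕ+} (hs : DisjointSupp ζ η)
    (hξ : ∀ i, ζ i = i → ξ i = i) (hχ : ∀ i, η i = i → χ i = i)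
    (hξ' : ∀ i, ζ i = i → ξ' i = i) (hχ' : ∀ i, η i = i → χ' i = i)
    (h : Crit (ξ * χ) (ξ' * χ')) : Crit ξ ξ' := by
  refine h.restrict_left (hs.mono hξ hχ') (hs.mono hξ' hχ') fun i hi => ?_
  rcases hs.disjoint i with hi' | hi'
  · have hν : (ξ * χ) i = i := h.fix (by rw [mul_apply_of_fix_right hi, hξ' i hi'])
    rwa [(hs.mono hξ hχ).mul_apply_of_fix (hξ i hi')] at hν
  · exact hχ i hi'

/-- Theorem C(i): for disjoint permutations `ζ` and `η`, the map
`(ξ,χ) ↦ ξ∘χ` is an isomorphism of graded posets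
`[e,ζ]_≼ × [e,η]_≼ ≅ [e,ζ∘η]_≼`. -/
theorem stmt15 (ζ η : Equiv.Perm ℕ+) (hζ : finSupp ζ) (hη : finSupp η)
    (hd : disjointPerm ζ η) :
    Set.BijOn (fun pr : Equiv.Perm ℕ+ × Equiv.Perm ℕ+ => pr.1 * pr.2)
      ({ξ | preceq ξ ζ} ×ˢ {χ | preceq χ η}) {ν | preceq ν (ζ * η)} ∧
    (∀ ξ χ ξ' χ' : Equiv.Perm ℕ+, preceq ξ ζ → preceq χ η → preceq ξ' ζ → preceq χ' η →
      ((preceq ξ ξ' ∧ preceq χ χ') ↔ preceq (ξ * χ) (ξ' * χ'))) ∧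
    (∀ ξ χ : Equiv.Perm ℕ+, preceq ξ ζ → preceq χ η →
      zlen (ξ * χ) = zlen ξ + zlen χ) := by
  obtain ⟨hs, hz⟩ := hd
  have hs : DisjointSupp ζ η := hs
  have hnc : Noncrossing ζ η := (hs.noncrossing_iff hζ hη).mpr hz
  refine ⟨⟨?_, ?_, ?_⟩, ?_, ?_⟩
  · rintro ⟨ξ, χ⟩ ⟨hξ, hχ⟩
    exact ((crit_of_preceq hξ).mul hs hnc (crit_of_preceq hχ)).preceq (hζ.mul hη)
  · rintro ⟨ξ, χ⟩ ⟨hξ, hχ⟩ ⟨ξ', χ'⟩ ⟨hξ', hχ'⟩ h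
    obtain rfl : ξ = ξ' := hs.injective_mul (fun _ => (crit_of_preceq hξ).fix)
      (fun _ => (crit_of_preceq hχ).fix) (fun _ => (crit_of_preceq hξ').fix)
      (fun _ => (crit_of_preceq hχ').fix) h
    obtain rfl : χ = χ' := mul_left_cancel h
    rfl
  · intro ν hν
    obtain ⟨ξ, χ, hξ, hχ, rfl⟩ := preceq.exists_factor hs hnc hζ hη hν
    exact ⟨(ξ, χ), ⟨hξ.preceq hζ, hχ.preceq hη⟩, rfl⟩
  · intro ξ χ ξ' χ' hξ hχ hξ' hχ'
    have hξ := crit_of_preceq hξ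
    have hχ := crit_of_preceq hχ
    have hξ' := crit_of_preceq hξ'
    have hχ' := crit_of_preceq hχ'
    have hfξ' := hξ'.finSupp hζ
    have hfχ' := hχ'.finSupp hη
    have hs' : DisjointSupp ξ' χ' := hs.mono (fun _ => hξ'.fix) fun _ => hχ'.fix
    constructor
    · rintro ⟨h1, h2⟩
      exact ((crit_of_preceq h1).mul hs' (hnc.of_crit hs hζ hη hξ' hχ')
        (crit_of_preceq h2)).preceq (hfξ'.mul hfχ')
    · intro h
      have h1 := crit_of_preceq h
      have h2 := h1
      rw [(hs.mono (fun _ => hξ.fix) fun _ => hχ.fix).commute, hs'.commute] at h2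
      exact ⟨(h1.left_of_mul hs (fun _ => hξ.fix) (fun _ => hχ.fix) (fun _ => hξ'.fix)
          fun _ => hχ'.fix).preceq hfξ',
        (h2.left_of_mul hs.symm (fun _ => hχ.fix) (fun _ => hξ.fix) (fun _ => hχ'.fix)
          fun _ => hξ'.fix).preceq hfχ'⟩
  · intro ξ χ hξ hχ
    have hξ := crit_of_preceq hξ
    have hχ := crit_of_preceq hχ
    exact ((hs.mono (fun _ => hξ.fix) fun _ => hχ.fix).noncrossing_iff (hξ.finSupp hζ)
      (hχ.finSupp hη)).mp (hnc.of_crit hs hζ hη hξ hχ)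
end

section
/- Let p, q be positive integers and x, z ∈ S_∞ with x ≤ z in the Bruhat order, and suppose ℓ(z) − ℓ(x) = ℓ(ε_{p,q}(z)) − ℓ(ε_{p,q}(x)). Then ε_{p,q} restricts to an order isomorphism from the Bruhat interval [x,z] := {v : x ≤ v ≤ z} onto the Bruhat interval [ε_{p,q}(x), ε_{p,q}(z)]: it is a bijection between these sets, and for all v, v' ∈ [x,z] one has v ≤ v' if and only if ε_{p,q}(v) ≤ ε_{p,q}(v'). -/
/-- Cover relation of the Bruhat order on `S_∞`. -/
def bruhatCover (u w : Equiv.Perm ℕ+) : Prop :=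
  ∃ a b : ℕ+, a ≠ b ∧ w = u * Equiv.swap a b ∧ len w = len u + 1

/-- The Bruhat order on `S_∞`. -/
def bruhatLE : Equiv.Perm ℕ+ → Equiv.Perm ℕ+ → Prop :=
  Relation.ReflTransGen bruhatCover

/-- `isEps p q w w'` says `w' = ε_{p,q}(w)`. -/
def isEps (p q : ℕ+) (w w' : Equiv.Perm ℕ+) : Prop :=
  (∀ j : ℕ+, j < p → (w j < q → w' j = w j) ∧ (q ≤ w j → w' j = w j + 1)) ∧
  w' p = q ∧
  (∀ j : ℕ+, p < j → (w (j - 1) < q → w' j = w (j - 1)) ∧ (q ≤ w (j - 1) → w' j = w (j - 1) + 1))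

/-- The set of inversions of a permutation of the positive integers. -/
def inversions (w : Equiv.Perm ℕ+) : Set (ℕ+ × ℕ+) :=
  {p : ℕ+ × ℕ+ | p.1 < p.2 ∧ w p.2 < w p.1}

/-- The rank function `#{k < m : w(k) < n}` of a permutation. -/
noncomputable def rank (w : Equiv.Perm ℕ+) (m n : ℕ+) : ℕ :=
  {k : ℕ+ | k < m ∧ w k < n}.ncard

/-- The increasing map `ℕ+ → ℕ+` whose range omits exactly `p`. -/
def skip (p j : ℕ+) : ℕ+ := if j < p then j else j + 1

theorem len_eq_ncard_inversions (w : Equiv.Perm ℕ+) : len w = (inversions w).ncard := rfl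

theorem finSupp.finite_inversions {w : Equiv.Perm ℕ+} (hw : finSupp w) :
    (inversions w).Finite := by
  obtain ⟨N, hN⟩ := hw.bddAbove
  have hfix : ∀ i, N < i → w i = i := fun i hi ↦ by
    by_contra h
    exact absurd (hN h) (not_le.2 hi)
  refine ((Set.finite_Iic N).prod (Set.finite_Iic N)).subset ?_
  rintro ⟨i, j⟩ ⟨hij, hw⟩
  simp only at hij hw
  have hj : j ≤ N := by
    by_contra! hj
    rw [hfix j hj] at hw
    have h := w.injective (hfix _ (hj.trans hw))
    rw [h] at hw
    exact absurd hw hij.not_gt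
  exact ⟨hij.le.trans hj, hj⟩

theorem len_mul_swap_le {u : Equiv.Perm ℕ+} (hu : (inversions u).Finite) {a b : ℕ+}
    (hab : a < b) (h : u b < u a) : len (u * Equiv.swap a b) ≤ len u := by
  set s := Equiv.swap a b with hs
  have hss : ∀ i, s (s i) = i := Equiv.swap_apply_self a b
  refine Set.ncard_le_ncard_of_injOn
    (fun t ↦ if s t.1 < s t.2 then (s t.1, s t.2) else t) ?_ ?_ hu
  · rintro ⟨i, j⟩ ⟨hij, hw⟩
    simp only [Equiv.Perm.coe_mul, Function.comp_apply] at hij hw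
    dsimp only
    split_ifs with hlt
    · exact ⟨hlt, hw⟩
    · refine ⟨hij, ?_⟩
      simp only [hs, Equiv.swap_apply_def] at hw hlt ⊢
      grind
  · rintro ⟨i, j⟩ ⟨hij, -⟩ ⟨i', j'⟩ ⟨hij', -⟩ heq
    have := hss i
    have := hss j
    have := hss i'
    have := hss j'
    simp only at hij hij' heq
    grind

theorem finite_setOf_lt_and (m : ℕ+) (P : ℕ+ → Prop) : {k : ℕ+ | k < m ∧ P k}.Finite :=
  (Set.finite_Iio m).subset fun _ h ↦ h.1

theorem rank_mul_swap_le {u : Equiv.Perm ℕ+} {a b : ℕ+} (hab : a < b) (h : u a < u b)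
    (m n : ℕ+) : rank (u * Equiv.swap a b) m n ≤ rank u m n := by
  set s := Equiv.swap a b with hs
  have hss : ∀ i, s (s i) = i := Equiv.swap_apply_self a b
  refine Set.ncard_le_ncard_of_injOn (fun k ↦ if s k < m then s k else k) ?_ ?_
    (finite_setOf_lt_and m _)
  · rintro k ⟨hk, hw⟩
    simp only [Equiv.Perm.coe_mul, Function.comp_apply] at hw
    split_ifs with hlt
    · exact ⟨hlt, hw⟩
    · refine ⟨hk, ?_⟩
      simp only [hs, Equiv.swap_apply_def] at hw hlt ⊢
      grind
  · rintro k ⟨hk, -⟩ k' ⟨hk', -⟩ heq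
    have := hss k
    have := hss k'
    grind

theorem bruhatCover.finite_inversions {u w : Equiv.Perm ℕ+} (h : bruhatCover u w) :
    (inversions w).Finite := by
  obtain ⟨a, b, -, -, hl⟩ := h
  exact Set.finite_of_ncard_pos (by rw [← len_eq_ncard_inversions]; omega)

theorem bruhatLE.finite_inversions {u w : Equiv.Perm ℕ+} (h : bruhatLE u w)
    (hu : (inversions u).Finite) : (inversions w).Finite := by
  rcases Relation.ReflTransGen.cases_tail h with rfl | ⟨c, -, hc⟩
  · exact hu
  · exact hc.finite_inversions

theorem bruhatCover.rank_le {u w : Equiv.Perm ℕ+} (h : bruhatCover u w)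
    (hu : (inversions u).Finite) (m n : ℕ+) : rank w m n ≤ rank u m n := by
  obtain ⟨a, b, hab, rfl, hl⟩ := h
  wlog hlt : a < b generalizing a b
  · rw [Equiv.swap_comm] at hl ⊢
    exact this b a hab.symm hl (lt_of_le_of_ne (not_lt.1 hlt) hab.symm)
  rcases lt_or_gt_of_ne (u.injective.ne hab) with h | h
  · exact rank_mul_swap_le hlt h m n
  · have := len_mul_swap_le hu hlt h
    omega

theorem bruhatLE.rank_le {u w : Equiv.Perm ℕ+} (h : bruhatLE u w)
    (hu : (inversions u).Finite) (m n : ℕ+) : rank w m n ≤ rank u m n := by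
  induction h with
  | refl => rfl
  | tail huc hc ih => exact (hc.rank_le (bruhatLE.finite_inversions huc hu) m n).trans ih

theorem skip_strictMono (p : ℕ+) : StrictMono (skip p) := by
  intro i j h
  unfold skip
  split_ifs <;> simp only [← PNat.coe_lt_coe, PNat.add_coe, PNat.one_coe] at * <;> omega

theorem skip_ne (p j : ℕ+) : skip p j ≠ p := by
  unfold skip
  split_ifs with h
  · exact h.ne
  · simp only [← PNat.coe_lt_coe, ne_eq, ← PNat.coe_inj, PNat.add_coe, PNat.one_coe] at *
    omega

theorem exists_skip_eq {p i : ℕ+} (h : i ≠ p) : ∃ j, skip p j = i := by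
  rcases lt_or_gt_of_ne h with h | h
  · exact ⟨i, if_pos h⟩
  · have h1 : i - 1 + 1 = i := PNat.sub_add_of_lt ((one_le (a := p)).trans_lt h)
    refine ⟨i - 1, ?_⟩
    rw [skip, if_neg, h1]
    rw [not_lt, ← PNat.lt_add_one_iff, h1]
    exact h

theorem skip_lt_iff (p j : ℕ+) : skip p j < p ↔ j < p := by
  unfold skip
  split_ifs
  · rfl
  · simp only [← PNat.coe_lt_coe, PNat.add_coe, PNat.one_coe] at *
    omega

theorem isEps.apply_skip {p q : ℕ+} {w w' : Equiv.Perm ℕ+} (h : isEps p q w w') (j : ℕ+) :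
    w' (skip p j) = skip q (w j) := by
  obtain ⟨h1, -, h3⟩ := h
  by_cases hj : j < p
  · rw [skip, if_pos hj, skip]
    split_ifs with hq
    · exact (h1 j hj).1 hq
    · exact (h1 j hj).2 (not_lt.1 hq)
  · have h3 := h3 (j + 1) (PNat.lt_add_one_iff.2 (not_lt.1 hj))
    rw [PNat.add_sub] at h3
    rw [skip, if_neg hj, skip]
    split_ifs with hq
    · exact h3.1 hq
    · exact h3.2 (not_lt.1 hq)

theorem perm_eq_of_apply_skip {p : ℕ+} {y y' : Equiv.Perm ℕ+} (h : y p = y' p)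
    (hs : ∀ j, y (skip p j) = y' (skip p j)) : y = y' := by
  ext1 i
  by_cases hi : i = p
  · rw [hi, h]
  · obtain ⟨j, rfl⟩ := exists_skip_eq hi
    exact hs j

theorem isEps.injective {p q : ℕ+} {w w' y : Equiv.Perm ℕ+} (h : isEps p q w y)
    (h' : isEps p q w' y) : w = w' := by
  ext1 j
  exact (skip_strictMono q).injective (by rw [← h.apply_skip, h'.apply_skip])

theorem isEps.mul_swap {p q : ℕ+} {w w' y y' : Equiv.Perm ℕ+} {a b : ℕ+}
    (h : isEps p q w y) (h' : isEps p q w' y') (hw : w' = w * Equiv.swap a b) :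
    y' = y * Equiv.swap (skip p a) (skip p b) := by
  subst hw
  refine perm_eq_of_apply_skip (p := p) ?_ fun j ↦ ?_
  · rw [Equiv.Perm.mul_apply,
      Equiv.swap_apply_of_ne_of_ne (skip_ne p a).symm (skip_ne p b).symm, h.2.1, h'.2.1]
  · rw [Equiv.Perm.mul_apply, (skip_strictMono p).injective.swap_apply, h.apply_skip,
      h'.apply_skip, Equiv.Perm.mul_apply]

theorem isEps.eq_mul_swap {p q : ℕ+} {E : Equiv.Perm ℕ+ → Equiv.Perm ℕ+}
    (hE : ∀ w, isEps p q w (E w)) {w : Equiv.Perm ℕ+} {a b : ℕ+} (hab : a ≠ b)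
    (h : (E w * Equiv.swap a b) p = q) :
    ∃ a' b', a' ≠ b' ∧ E w * Equiv.swap a b = E (w * Equiv.swap a' b') := by
  have hs : Equiv.swap a b p = p := (E w).injective (by rw [(hE w).2.1]; exact h)
  have ha : a ≠ p := by
    rintro rfl
    rw [Equiv.swap_apply_left] at hs
    exact hab hs.symm
  have hb : b ≠ p := by
    rintro rfl
    rw [Equiv.swap_apply_right] at hs
    exact hab hs
  obtain ⟨a', rfl⟩ := exists_skip_eq ha
  obtain ⟨b', rfl⟩ := exists_skip_eq hb
  exact ⟨a', b', fun h ↦ hab (by rw [h]), ((hE w).mul_swap (hE _) rfl).symm⟩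

theorem inversions_eq_of_isEps {p q : ℕ+} {w y : Equiv.Perm ℕ+} (h : isEps p q w y) :
    inversions y = Prod.map (skip p) (skip p) '' inversions w ∪
      ((fun i ↦ (i, p)) '' {i | i < p ∧ ¬ y i < q} ∪
        (fun i ↦ (p, i)) '' {i | y i < q ∧ ¬ i < p}) := by
  have hp := h.2.1
  have hm := skip_strictMono p
  have hm' := skip_strictMono q
  have hyp : ∀ i, y i = q ↔ i = p := fun i ↦ by rw [← hp, y.injective.eq_iff]
  ext ⟨i, j⟩
  simp only [inversions, Set.mem_union, Set.mem_image, Set.mem_ofPred_eq, Prod.exists,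
    Prod.map_apply, Prod.mk.injEq]
  constructor
  · rintro ⟨hij, hy⟩
    by_cases hi : i = p
    · subst hi
      exact .inr (.inr ⟨j, ⟨hp ▸ hy, hij.not_gt⟩, rfl, rfl⟩)
    by_cases hj : j = p
    · subst hj
      exact .inr (.inl ⟨i, ⟨hij, (hp ▸ hy).not_gt⟩, rfl, rfl⟩)
    obtain ⟨i, rfl⟩ := exists_skip_eq hi
    obtain ⟨j, rfl⟩ := exists_skip_eq hj
    rw [h.apply_skip, h.apply_skip] at hy
    exact .inl ⟨i, j, ⟨hm.lt_iff_lt.1 hij, hm'.lt_iff_lt.1 hy⟩, rfl, rfl⟩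
  · rintro (⟨i, j, ⟨hij, hw⟩, rfl, rfl⟩ | ⟨i, ⟨h1, h2⟩, rfl, rfl⟩ | ⟨j, ⟨h1, h2⟩, rfl, rfl⟩)
    · rw [h.apply_skip, h.apply_skip]
      exact ⟨hm hij, hm' hw⟩
    · have := (hyp i).not.2 h1.ne
      rw [hp]
      exact ⟨h1, by grind⟩
    · have : j ≠ p := (hyp j).not.1 h1.ne
      rw [hp]
      exact ⟨by grind, h1⟩

theorem finite_setOf_apply_lt (y : Equiv.Perm ℕ+) (q : ℕ+) : {i | y i < q}.Finite :=
  (Set.finite_Iio q).preimage y.injective.injOn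

theorem isEps.finite_inversions {p q : ℕ+} {w y : Equiv.Perm ℕ+} (h : isEps p q w y)
    (hw : (inversions w).Finite) : (inversions y).Finite := by
  rw [inversions_eq_of_isEps h]
  exact (hw.image _).union (((finite_setOf_lt_and p _).image _).union
    (((finite_setOf_apply_lt y q).subset fun _ h ↦ h.1).image _))

theorem isEps.len_add {p q : ℕ+} {w y : Equiv.Perm ℕ+} (h : isEps p q w y)
    (hw : (inversions w).Finite) :
    len y + 2 * rank y p q = len w + ((Set.Iio p).ncard + (Set.Iio q).ncard) := by
  have hB : {i | i < p ∧ ¬ y i < q}.Finite := finite_setOf_lt_and p _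
  have hC : {i | y i < q ∧ ¬ i < p}.Finite :=
    (finite_setOf_apply_lt y q).subset fun _ h ↦ h.1
  have hlen : len y = len w +
      ({i | i < p ∧ ¬ y i < q}.ncard + {i | y i < q ∧ ¬ i < p}.ncard) := by
    rw [len_eq_ncard_inversions, len_eq_ncard_inversions, inversions_eq_of_isEps h,
      Set.ncard_union_eq _ (hw.image _) ((hB.image _).union (hC.image _)),
      Set.ncard_union_eq _ (hB.image _) (hC.image _),
      Set.ncard_image_of_injective _
        ((skip_strictMono p).injective.prodMap (skip_strictMono p).injective),
      Set.ncard_image_of_injective _ (Prod.mk_left_injective p),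
      Set.ncard_image_of_injective _ (Prod.mk_right_injective p)]
    · rw [Set.disjoint_left]
      rintro _ ⟨i, hi, rfl⟩ ⟨j, hj, h⟩
      rw [Prod.mk.injEq] at h
      exact absurd hi.1 (by rw [← h.1]; exact lt_irrefl p)
    · rw [Set.disjoint_left]
      rintro _ ⟨⟨i, j⟩, -, rfl⟩ (⟨k, -, h⟩ | ⟨k, -, h⟩) <;>
        rw [Prod.map_apply, Prod.mk.injEq] at h
      · exact skip_ne p j h.2.symm
      · exact skip_ne p i h.1.symm
  have hp : (Set.Iio p).ncard = rank y p q + {i | i < p ∧ ¬ y i < q}.ncard :=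
    (Set.ncard_inter_add_ncard_sdiff_eq_ncard (Set.Iio p) {i | y i < q} (Set.finite_Iio p)).symm
  have hq : {i | y i < q}.ncard = rank y p q + {i | y i < q ∧ ¬ i < p}.ncard := by
    rw [← Set.ncard_inter_add_ncard_sdiff_eq_ncard {i | y i < q} (Set.Iio p)
      (finite_setOf_apply_lt y q), Set.inter_comm]
    rfl
  have hq' : {i | y i < q}.ncard = (Set.Iio q).ncard :=
    Set.ncard_preimage_of_injective_subset_range y.injective
      (s := Set.Iio q) (by rw [y.surjective.range_eq]; exact Set.subset_univ _)
  omega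

theorem isEps.rank_eq {p q : ℕ+} {w y : Equiv.Perm ℕ+} (h : isEps p q w y) :
    rank y p q = rank w p q := by
  unfold rank
  congr 1
  ext k
  refine and_congr_right fun hk ↦ ?_
  have := h.apply_skip k
  rw [skip, if_pos hk] at this
  rw [this, skip_lt_iff]

theorem rank_add_one_left_of_lt {y : Equiv.Perm ℕ+} {m n : ℕ+} (h : y m < n) :
    rank y (m + 1) n = rank y m n + 1 := by
  unfold rank
  rw [← Set.ncard_insert_of_notMem (a := m) (fun h ↦ lt_irrefl _ h.1) (finite_setOf_lt_and m _)]
  congr 1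
  ext k
  simp only [Set.mem_ofPred_eq, Set.mem_insert_iff, PNat.lt_add_one_iff]
  grind

theorem rank_add_one_left_of_le {y : Equiv.Perm ℕ+} {m n : ℕ+} (h : n ≤ y m) :
    rank y (m + 1) n = rank y m n := by
  unfold rank
  congr 1
  ext k
  simp only [Set.mem_ofPred_eq, PNat.lt_add_one_iff]
  grind

theorem rank_add_one_right_of_le {y : Equiv.Perm ℕ+} {m n : ℕ+} (h : m ≤ y.symm n) :
    rank y m (n + 1) = rank y m n := by
  unfold rank
  congr 1
  ext k
  have : y k = n ↔ k = y.symm n := by rw [Equiv.eq_symm_apply]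
  simp only [Set.mem_ofPred_eq, PNat.lt_add_one_iff]
  grind

theorem apply_eq_of_bruhatLE {p q : ℕ+} {u c w : Equiv.Perm ℕ+} (hu : (inversions u).Finite)
    (huc : bruhatLE u c) (hcw : bruhatLE c w) (hup : u p = q) (hwp : w p = q)
    (hr : rank w p q = rank u p q) : c p = q := by
  have hc := huc.finite_inversions hu
  have key : ∀ y : Equiv.Perm ℕ+, y p = q → rank y (p + 1) q = rank y p q ∧
      rank y p (q + 1) = rank y p q ∧ rank y (p + 1) (q + 1) = rank y p q + 1 := fun y hy ↦ by
    have h1 : rank y p (q + 1) = rank y p q :=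
      rank_add_one_right_of_le (by rw [← hy, Equiv.symm_apply_apply])
    refine ⟨rank_add_one_left_of_le hy.ge, h1, ?_⟩
    rw [rank_add_one_left_of_lt (by rw [hy]; exact PNat.lt_add_one_iff.2 le_rfl), h1]
  obtain ⟨hu1, hu2, hu3⟩ := key u hup
  obtain ⟨hw1, hw2, hw3⟩ := key w hwp
  have hbd := fun m n ↦ And.intro (huc.rank_le hu m n) (hcw.rank_le hc m n)
  have h1 := hbd p q
  have h2 := hbd (p + 1) q
  have h3 := hbd p (q + 1)
  have h4 := hbd (p + 1) (q + 1)
  refine le_antisymm ?_ ?_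
  · by_contra! h
    have := rank_add_one_left_of_le (PNat.add_one_le_iff.2 h)
    omega
  · by_contra! h
    have := rank_add_one_left_of_lt h
    omega

theorem exists_eq_of_apply_eq {p q : ℕ+} {E : Equiv.Perm ℕ+ → Equiv.Perm ℕ+}
    (hE : ∀ w, isEps p q w (E w)) {v u w : Equiv.Perm ℕ+} (hv : (inversions v).Finite)
    (h : bruhatLE u w) (hu : u = E v) (hw : w p = q) (hr : rank w p q = rank u p q) :
    ∃ v', w = E v' ∧ bruhatLE v v' := by
  induction h using Relation.ReflTransGen.head_induction_on generalizing v with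
  | refl => exact ⟨v, hu, .refl⟩
  | @head u c huc hcw ih =>
    subst hu
    have hEv := (hE v).finite_inversions hv
    have hc := huc.finite_inversions
    have hcp := apply_eq_of_bruhatLE hEv (.single huc) hcw (hE v).2.1 hw hr
    have h1 := huc.rank_le hEv p q
    have h2 := bruhatLE.rank_le hcw hc p q
    obtain ⟨a, b, hab, rfl, hl⟩ := huc
    obtain ⟨a', b', hab', heq⟩ := isEps.eq_mul_swap hE hab hcp
    rw [heq] at hc h1 h2 hl ih
    have hv' : (inversions (v * Equiv.swap a' b')).Finite := by
      refine (hc.preimage ((skip_strictMono p).injective.prodMap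
        (skip_strictMono p).injective).injOn).subset fun t ht ↦ ?_
      rw [inversions_eq_of_isEps (hE _)]
      exact .inl ⟨t, ht, rfl⟩
    have h3 := (hE v).len_add hv
    have h4 := (hE _).len_add hv'
    obtain ⟨v', hwv', hle⟩ := ih hv' rfl (by omega)
    exact ⟨v', hwv', .head ⟨a', b', hab', rfl, by omega⟩ hle⟩

theorem bruhatLE.map_of_rank_eq {p q : ℕ+} {E : Equiv.Perm ℕ+ → Equiv.Perm ℕ+}
    (hE : ∀ w, isEps p q w (E w)) {v w : Equiv.Perm ℕ+} (hv : (inversions v).Finite)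
    (h : bruhatLE v w) (hr : rank w p q = rank v p q) : bruhatLE (E v) (E w) := by
  induction h using Relation.ReflTransGen.head_induction_on with
  | refl => exact .refl
  | @head v c hvc hcw ih =>
    have hc := hvc.finite_inversions
    have h1 := hvc.rank_le hv p q
    have h2 := bruhatLE.rank_le hcw hc p q
    refine .head ?_ (ih hc (by omega))
    have h3 := (hE v).len_add hv
    have h4 := (hE c).len_add hc
    rw [(hE _).rank_eq] at h3 h4
    obtain ⟨a, b, hab, hcv, hl⟩ := hvc
    exact ⟨_, _, (skip_strictMono p).injective.ne hab, (hE v).mul_swap (hE c) hcv, by omega⟩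

/-- Lemma 4.1.1(ii): if `ℓ(z) − ℓ(x) = ℓ(ε_{p,q}(z)) − ℓ(ε_{p,q}(x))`, then
`ε_{p,q}` restricts to an order isomorphism `[x,z] ≅ [ε_{p,q}(x), ε_{p,q}(z)]`
of Bruhat intervals. -/
theorem stmt17 (p q : ℕ+) (E : Equiv.Perm ℕ+ → Equiv.Perm ℕ+)
    (hE : ∀ w, isEps p q w (E w))
    (x z : Equiv.Perm ℕ+) (hx : finSupp x) (hz : finSupp z)
    (hxz : bruhatLE x z)
    (hlen : (len z : ℤ) - (len x : ℤ) = (len (E z) : ℤ) - (len (E x) : ℤ)) :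
    Set.BijOn E {v | bruhatLE x v ∧ bruhatLE v z}
      {v | bruhatLE (E x) v ∧ bruhatLE v (E z)} ∧
    ∀ v v' : Equiv.Perm ℕ+,
      (bruhatLE x v ∧ bruhatLE v z) → (bruhatLE x v' ∧ bruhatLE v' z) →
      (bruhatLE v v' ↔ bruhatLE (E v) (E v')) := by
  have hx' := hx.finite_inversions
  have hrank : rank z p q = rank x p q := by
    have h1 := (hE x).len_add hx'
    have h2 := (hE z).len_add hz.finite_inversions
    rw [(hE _).rank_eq] at h1 h2
    omega
  have hmem : ∀ v, bruhatLE x v ∧ bruhatLE v z →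
      (inversions v).Finite ∧ rank v p q = rank x p q := fun v ⟨h1, h2⟩ ↦ by
    have hv := h1.finite_inversions hx'
    exact ⟨hv, le_antisymm (h1.rank_le hx' p q) (hrank ▸ h2.rank_le hv p q)⟩
  have hmap : ∀ v v', bruhatLE x v ∧ bruhatLE v z → bruhatLE x v' ∧ bruhatLE v' z →
      bruhatLE v v' → bruhatLE (E v) (E v') := fun v v' hv hv' h ↦
    h.map_of_rank_eq hE (hmem v hv).1 ((hmem v' hv').2.trans (hmem v hv).2.symm)
  have hinj : Function.Injective E := fun v v' h ↦ (hE v).injective (h ▸ hE v')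
  have hreflect : ∀ v v', (inversions v).Finite → rank v' p q = rank v p q →
      bruhatLE (E v) (E v') → bruhatLE v v' := fun v v' hv hr h ↦ by
    obtain ⟨u, hu, hle⟩ := exists_eq_of_apply_eq hE hv h rfl (hE v').2.1
      (by rw [(hE _).rank_eq, (hE _).rank_eq, hr])
    rwa [hinj hu]
  have hxx : bruhatLE x x ∧ bruhatLE x z := ⟨.refl, hxz⟩
  have hzz : bruhatLE x z ∧ bruhatLE z z := ⟨hxz, .refl⟩
  refine ⟨⟨fun v hv ↦ ⟨hmap x v hxx hv hv.1, hmap v z hv hzz hv.2⟩, hinj.injOn, ?_⟩,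
    fun v v' hv hv' ↦ ⟨hmap v v' hv hv', hreflect v v' (hmem v hv).1
      ((hmem v' hv').2.trans (hmem v hv).2.symm)⟩⟩
  rintro y ⟨hxy, hyz⟩
  have hEx := (hE x).finite_inversions hx'
  have hEr : rank (E z) p q = rank (E x) p q := by rw [(hE _).rank_eq, (hE _).rank_eq, hrank]
  have hyr : rank y p q = rank (E x) p q :=
    le_antisymm (hxy.rank_le hEx p q) (hEr ▸ hyz.rank_le (hxy.finite_inversions hEx) p q)
  obtain ⟨v, rfl, hxv⟩ := exists_eq_of_apply_eq hE hx' hxy rfl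
    (apply_eq_of_bruhatLE hEx hxy hyz (hE x).2.1 (hE z).2.1 hEr) hyr
  rw [(hE _).rank_eq, (hE _).rank_eq] at hyr
  exact ⟨v, ⟨hxv, hreflect v z (hxv.finite_inversions hx') (hrank.trans hyr.symm) hyz⟩, rfl⟩
end
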